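/- For all integers n ≥ 0, Z_l(n,0) = Z_r(n,0). -/

import Mathlib

open scoped BigOperators

/-- The Pochhammer symbol `(x)_k = x (x+1) ⋯ (x+k-1)` for a real `x`. -/
noncomputable def poch (x : ℝ) (k : ℕ) : ℝ := ∏ i ∈ Finset.range k, (x + i)

/-- The rational function `R_{n,m}(t)` from the paper. -/
noncomputable def R (n m : ℕ) (t : ℝ) : ℝ :=
  (-1 : ℝ) ^ m * (t + n / 2) * (poch (t - n) m / m.factorial) *
    (poch (t - 2 * n + m) (2 * n - m) / (2 * n - m).factorial) *
    (poch (t + n + 1) n / poch t (n + 1)) *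
    (poch (t + n + 1) (2 * n - m) / poch t (2 * n - m + 1)) *
    ((n.factorial : ℝ) / poch t (n + 1)) ^ 2

/-- The rational function `R̃_{n,m}(t)` from the paper. -/
noncomputable def Rtilde (n m : ℕ) (t : ℝ) : ℝ :=
  ((n.factorial : ℝ) * poch (t - n) (2 * n - m) / (poch t (n + 1) * poch t (2 * n - m + 1))) *
    ∑ j ∈ Finset.range (n + 1),
      (n.choose j : ℝ) ^ 2 * ((2 * n - m + j).choose n : ℝ) * poch (t - j) n / n.factorial

/-- `Z_l(n,m) = -(1/3) Σ_{ν=n-m+1}^∞ (d/dt R_{n,m}(t))|_{t=ν}`. -/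
noncomputable def Zl (n m : ℕ) : ℝ :=
  -(1 / 3) * ∑' ν : ℕ, deriv (R n m) ((n : ℝ) - m + 1 + ν)

/-- `Z_r(n,m) = (1/6) Σ_{ν=1}^∞ (d²/dt² R̃_{n,m}(t))|_{t=ν}`. -/
noncomputable def Zr (n m : ℕ) : ℝ :=
  (1 / 6) * ∑' ν : ℕ, deriv (deriv (Rtilde n m)) (1 + (ν : ℝ))

/-- `U_k(n) = Σ_{i=0}^n C(4i,2i) / ((2i+1)^k C(2i,i)^8)`. -/
noncomputable def U (k n : ℕ) : ℝ :=
  ∑ i ∈ Finset.range (n + 1),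
    ((4 * i).choose (2 * i) : ℝ) / ((2 * i + 1) ^ k * ((2 * i).choose i : ℝ) ^ 8)

/-- The harmonic number `S₁(N) = Σ_{i=1}^N 1/i`. -/
noncomputable def S1 (N : ℕ) : ℝ := ∑ i ∈ Finset.range N, (1 : ℝ) / (i + 1)

open Filter Topology Asymptotics Polynomial in
/-- `f` agrees on `(0, ∞)` with a rational function without poles there, of degree at most `-k`. -/
def RatDecay (k : ℤ) (f : ℝ → ℝ) : Prop :=
  ∃ P Q : Polynomial ℝ, (∀ t : ℝ, 0 < t → Q.eval t ≠ 0) ∧ 1 ≤ Q.natDegree ∧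
    (P.natDegree : ℤ) + k ≤ Q.natDegree ∧ ∀ t : ℝ, 0 < t → f t = P.eval t / Q.eval t

namespace RatDecay

open Filter Topology Asymptotics Polynomial

variable {k l : ℤ} {f g : ℝ → ℝ}

theorem congr (hf : RatDecay k f) (h : ∀ t : ℝ, 0 < t → g t = f t) : RatDecay k g := by
  obtain ⟨P, Q, h0, h1, h2, h3⟩ := hf
  exact ⟨P, Q, h0, h1, h2, fun t ht => (h t ht).trans (h3 t ht)⟩

theorem mono (hf : RatDecay k f) (h : l ≤ k) : RatDecay l f := by
  obtain ⟨P, Q, h0, h1, h2, h3⟩ := hf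
  exact ⟨P, Q, h0, h1, by lia, h3⟩

theorem poly (P : ℝ[X]) (h : k + P.natDegree ≤ 0) : RatDecay k (fun t => P.eval t) := by
  refine ⟨P * X, X, fun t ht => by simpa using ht.ne', by simp, ?_, fun t ht => ?_⟩
  · have := natDegree_mul_le (p := P) (q := X)
    rw [natDegree_X] at this ⊢
    push_cast
    lia
  · simp [ht.ne']

theorem const (c : ℝ) : RatDecay 0 (fun _ => c) :=
  (poly (k := 0) (C c) (by simp)).congr fun t _ => by simp

theorem linear (c : ℝ) : RatDecay (-1) (fun t => t + c) :=
  (poly (k := -1) (X + C c) (by simp)).congr fun t _ => by simp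

theorem id : RatDecay (-1) (fun t => t) := by simpa using linear 0

theorem inv_linear {c : ℝ} (hc : 0 ≤ c) : RatDecay 1 (fun t => (t + c)⁻¹) :=
  ⟨1, X + C c, fun t ht => by simpa using (by positivity), by simp, by simp, fun t _ => by simp⟩

theorem add (hf : RatDecay k f) (hg : RatDecay k g) : RatDecay k (fun t => f t + g t) := by
  obtain ⟨P, Q, h0, h1, h2, h3⟩ := hf
  obtain ⟨P', Q', h0', h1', h2', h3'⟩ := hg
  have hQ : Q ≠ 0 := by rintro rfl; simp at h1
  have hQ' : Q' ≠ 0 := by rintro rfl; simp at h1'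
  refine ⟨P * Q' + P' * Q, Q * Q', fun t ht => ?_, ?_, ?_, fun t ht => ?_⟩
  · rw [eval_mul]; exact mul_ne_zero (h0 t ht) (h0' t ht)
  · rw [natDegree_mul hQ hQ']; lia
  · rw [natDegree_mul hQ hQ']
    have a := natDegree_add_le (P * Q') (P' * Q)
    have b := natDegree_mul_le (p := P) (q := Q')
    have c := natDegree_mul_le (p := P') (q := Q)
    rcases le_max_iff.1 a with a | a <;> push_cast <;> lia
  · simp only [h3 t ht, h3' t ht]
    rw [div_add_div _ _ (h0 t ht) (h0' t ht)]
    simp only [eval_add, eval_mul]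
    ring

theorem mul (hf : RatDecay k f) (hg : RatDecay l g) : RatDecay (k + l) (fun t => f t * g t) := by
  obtain ⟨P, Q, h0, h1, h2, h3⟩ := hf
  obtain ⟨P', Q', h0', h1', h2', h3'⟩ := hg
  have hQ : Q ≠ 0 := by rintro rfl; simp at h1
  have hQ' : Q' ≠ 0 := by rintro rfl; simp at h1'
  refine ⟨P * P', Q * Q', fun t ht => ?_, ?_, ?_, fun t ht => ?_⟩
  · rw [eval_mul]; exact mul_ne_zero (h0 t ht) (h0' t ht)
  · rw [natDegree_mul hQ hQ']; lia
  · rw [natDegree_mul hQ hQ']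
    have b := natDegree_mul_le (p := P) (q := P')
    push_cast
    lia
  · simp only [h3 t ht, h3' t ht]
    rw [div_mul_div_comm, eval_mul, eval_mul]

theorem const_mul (c : ℝ) (hf : RatDecay k f) : RatDecay k (fun t => c * f t) := by
  simpa using (const c).mul hf

theorem neg (hf : RatDecay k f) : RatDecay k (fun t => - f t) := by
  simpa using hf.const_mul (-1)

theorem sub (hf : RatDecay k f) (hg : RatDecay k g) : RatDecay k (fun t => f t - g t) := by
  simpa [sub_eq_add_neg] using hf.add hg.neg

theorem pow (hf : RatDecay k f) (m : ℕ) : RatDecay (m * k) (fun t => f t ^ m) := by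
  induction m with
  | zero => simpa using const 1
  | succ m ih =>
    refine ((ih.mul hf).mono (le_of_eq ?_)).congr fun t _ => pow_succ _ _
    push_cast
    ring

theorem sum {ι : Type*} (s : Finset ι) (F : ι → ℝ → ℝ) (hk : k ≤ 0)
    (h : ∀ i ∈ s, RatDecay k (F i)) : RatDecay k (fun t => ∑ i ∈ s, F i t) := by
  classical
  induction s using Finset.induction_on with
  | empty => simpa only [Finset.sum_empty] using (const 0).mono hk
  | insert a s ha ih =>
    simp only [Finset.sum_insert ha]
    exact (h a (by simp)).add (ih fun i hi => h i (by simp [hi]))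

/-- One step of Horner's scheme. -/
theorem horner (c : ℝ) (hk : k ≤ 0) (hf : RatDecay k f) :
    RatDecay (k - 1) (fun t => c + t * f t) :=
  ((const c).mono (by lia)).add ((id.mul hf).mono (by lia))

theorem hasDerivAt_quot {P Q : ℝ[X]} {t : ℝ} (hQ : Q.eval t ≠ 0) :
    HasDerivAt (fun t => P.eval t / Q.eval t)
      ((derivative P * Q - P * derivative Q).eval t / (Q * Q).eval t) t := by
  refine ((P.hasDerivAt t).fun_div (Q.hasDerivAt t) hQ).congr_deriv ?_
  simp only [eval_sub, eval_mul, sq]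

theorem differentiableAt (hf : RatDecay k f) {t : ℝ} (ht : 0 < t) : DifferentiableAt ℝ f t := by
  obtain ⟨P, Q, h0, h1, h2, h3⟩ := hf
  refine (hasDerivAt_quot (P := P) (h0 t ht)).differentiableAt.congr_of_eventuallyEq ?_
  filter_upwards [lt_mem_nhds ht] with x hx using h3 x hx

theorem deriv (hf : RatDecay k f) : RatDecay (k + 1) (deriv f) := by
  obtain ⟨P, Q, h0, h1, h2, h3⟩ := hf
  have hQ : Q ≠ 0 := by rintro rfl; simp at h1
  refine ⟨derivative P * Q - P * derivative Q, Q * Q, fun t ht => ?_, ?_, ?_, fun t ht => ?_⟩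
  · rw [eval_mul]; exact mul_ne_zero (h0 t ht) (h0 t ht)
  · rw [natDegree_mul hQ hQ]; lia
  · rw [natDegree_mul hQ hQ]
    have a := natDegree_sub_le (derivative P * Q) (P * derivative Q)
    have b := natDegree_mul_le (p := P) (q := derivative Q)
    have c := natDegree_mul_le (p := derivative P) (q := Q)
    have d := natDegree_derivative_le P
    have e := natDegree_derivative_le Q
    rcases Nat.eq_zero_or_pos P.natDegree with hP | hP
    · rw [derivative_of_natDegree_zero hP, zero_mul, zero_sub, natDegree_neg]
      push_cast
      lia
    · rcases le_max_iff.1 a with a | a <;> push_cast <;> lia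
  · have : f =ᶠ[𝓝 t] fun t => P.eval t / Q.eval t := by
      filter_upwards [lt_mem_nhds ht] with x hx using h3 x hx
    rw [this.deriv_eq, (hasDerivAt_quot (h0 t ht)).deriv]

theorem tendsto (hf : RatDecay k f) (hk : 1 ≤ k) : Tendsto f atTop (𝓝 0) := by
  obtain ⟨P, Q, h0, h1, h2, h3⟩ := hf
  refine (div_tendsto_atTop_zero_of_degree_lt P Q (degree_lt_degree (by lia))).congr' ?_
  filter_upwards [eventually_gt_atTop 0] with t ht using (h3 t ht).symm

theorem summable (hf : RatDecay k f) (hk : 2 ≤ k) {a : ℝ} (ha : 0 < a) :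
    Summable (fun ν : ℕ => f (a + ν)) := by
  obtain ⟨P, Q, h0, h1, h2, h3⟩ := (id.pow 2).mul hf
  have hQ : Q ≠ 0 := by rintro rfl; simp at h1
  have hO : (fun t => P.eval t) =O[atTop] fun t => Q.eval t :=
    isBigO_atTop_of_degree_le P Q (by
      rw [degree_eq_natDegree hQ]
      exact degree_le_natDegree.trans (by exact_mod_cast (by lia)))
  have hf2 : f =O[atTop] fun t : ℝ => (t ^ 2)⁻¹ := by
    have h4 : (fun t => P.eval t / Q.eval t * (t ^ 2)⁻¹) =O[atTop]
        fun t : ℝ => (1 : ℝ) * (t ^ 2)⁻¹ := by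
      refine IsBigO.mul ?_ (isBigO_refl _ _)
      refine (hO.mul (isBigO_refl (fun t => (Q.eval t)⁻¹) _)).congr' ?_ ?_
      · exact Eventually.of_forall fun t => (div_eq_mul_inv _ _).symm
      · filter_upwards [eventually_gt_atTop 0] with t ht using mul_inv_cancel₀ (h0 t ht)
    refine h4.congr' ?_ (by simp)
    filter_upwards [eventually_gt_atTop 0] with t ht
    rw [← h3 t ht]
    field_simp
  have ht : Tendsto (fun ν : ℕ => a + (ν : ℝ)) atTop atTop :=
    tendsto_atTop_add_const_left _ _ tendsto_natCast_atTop_atTop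
  refine summable_of_isBigO_nat (Real.summable_nat_pow_inv.2 (by norm_num : 1 < 2)) ?_
  refine (hf2.comp_tendsto ht).trans (IsBigO.of_bound 1 ?_)
  filter_upwards [eventually_gt_atTop 0] with ν hν
  have : (0 : ℝ) < ν := by exact_mod_cast hν
  simp only [Function.comp_apply, norm_inv, norm_pow, one_mul, Real.norm_eq_abs, sq_abs]
  gcongr
  linarith

end RatDecay

open Filter Topology in
/-- Summation of a telescoping rational function. -/
theorem tsum_telescope {f G : ℝ → ℝ} {a : ℝ} (hG : Tendsto G atTop (𝓝 0))
    (h : ∀ ν : ℕ, f (a + ν) = G (a + ν + 1) - G (a + ν)) (hf : Summable fun ν : ℕ => f (a + ν)) :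
    ∑' ν : ℕ, f (a + ν) = - G a := by
  have ht : Tendsto (fun ν : ℕ => a + (ν : ℝ)) atTop atTop :=
    tendsto_atTop_add_const_left _ _ tendsto_natCast_atTop_atTop
  have h1 := hf.hasSum.tendsto_sum_nat
  have h2 : ∀ N : ℕ, ∑ ν ∈ Finset.range N, f (a + ν) = G (a + N) - G a := by
    intro N
    induction N with
    | zero => simp
    | succ N ih => rw [Finset.sum_range_succ, ih, h]; push_cast; rw [add_assoc]; ring
  simp only [h2] at h1
  refine tendsto_nhds_unique h1 ?_
  simpa using (hG.comp ht).sub_const (G a)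

open Filter Topology in
/-- A telescoping identity can be differentiated. -/
theorem deriv_telescope {k : ℤ} {f G : ℝ → ℝ} (hG : RatDecay k G)
    (h : ∀ t, 0 < t → f t = G (t + 1) - G t) (t : ℝ) (ht : 0 < t) :
    deriv f t = deriv G (t + 1) - deriv G t := by
  have : f =ᶠ[𝓝 t] fun t => G (t + 1) - G t := by
    filter_upwards [lt_mem_nhds ht] with x hx using h x hx
  rw [this.deriv_eq]
  have h1 : HasDerivAt (fun t => G (t + 1)) (deriv G (t + 1)) t :=
    ((hG.differentiableAt (by positivity)).hasDerivAt).comp_add_const t 1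
  exact (h1.sub (hG.differentiableAt ht).hasDerivAt).deriv

theorem poch_zero (x : ℝ) : poch x 0 = 1 := by simp [poch]

theorem poch_succ (x : ℝ) (k : ℕ) : poch x (k + 1) = poch x k * (x + k) := by
  simp [poch, Finset.prod_range_succ]

theorem poch_add (x : ℝ) (k l : ℕ) : poch x (k + l) = poch x k * poch (x + k) l := by
  simp only [poch, Finset.prod_range_add, Nat.cast_add, add_assoc]

theorem poch_succ' (x : ℝ) (k : ℕ) : poch x (k + 1) = x * poch (x + 1) k := by
  rw [add_comm k 1, poch_add]
  simp [poch]

theorem poch_pos {x : ℝ} (hx : 0 < x) (k : ℕ) : 0 < poch x k :=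
  Finset.prod_pos fun i _ => by positivity

theorem RatDecay.poch (c : ℝ) (k : ℕ) : RatDecay (-k) (fun t => poch (t + c) k) := by
  induction k with
  | zero => simpa [poch_zero] using RatDecay.const 1
  | succ k ih =>
    refine ((ih.mul (RatDecay.linear (c + k))).mono ?_).congr fun t _ => ?_
    · push_cast
      lia
    · rw [poch_succ, add_assoc]

theorem RatDecay.inv_poch {c : ℝ} (hc : 0 ≤ c) (k : ℕ) :
    RatDecay k (fun t => (_root_.poch (t + c) k)⁻¹) := by
  induction k with
  | zero => simpa [poch_zero] using RatDecay.const 1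
  | succ k ih =>
    refine ((ih.mul (RatDecay.inv_linear (c := c + k) (by positivity))).mono ?_).congr
      fun t _ => ?_
    · push_cast
      lia
    · rw [poch_succ, mul_inv, add_assoc]

/-- The weight `C(n,j)² C(2n+j,n)`. -/
noncomputable def wt (n j : ℕ) : ℝ := (n.choose j : ℝ) ^ 2 * ((2 * n + j).choose n : ℝ)

/-- The polynomial `∑ⱼ C(n,j)² C(2n+j,n) (t-j)ₙ`. -/
noncomputable def Sh (n : ℕ) (t : ℝ) : ℝ := ∑ j ∈ Finset.range (n + 1), wt n j * poch (t - j) n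

theorem choose_succ_right_real (n j : ℕ) :
    (n.choose (j + 1) : ℝ) * (j + 1) = n.choose j * (n - j) := by
  rcases le_or_gt j n with h | h
  · have := Nat.choose_succ_right_eq n j
    rw [← Nat.cast_sub h]
    exact_mod_cast this
  · simp [Nat.choose_eq_zero_of_lt h, Nat.choose_eq_zero_of_lt (h.trans (Nat.lt_succ_self j))]

theorem choose_succ_left_real {n k : ℕ} (h : k ≤ n) :
    ((n + 1).choose k : ℝ) * (n + 1 - k) = n.choose k * (n + 1) := by
  have := Nat.choose_mul_succ_eq n k
  rw [← Nat.cast_succ, ← Nat.cast_sub (h.trans n.le_succ)]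
  exact_mod_cast this.symm

theorem wt_eq_zero {n j : ℕ} (h : n < j) : wt n j = 0 := by
  simp [wt, Nat.choose_eq_zero_of_lt h]

theorem wt_succ_right (n j : ℕ) :
    wt n (j + 1) * ((j + 1) ^ 2 * (n + j + 1)) = wt n j * ((n - j) ^ 2 * (2 * n + j + 1)) := by
  have h1 := choose_succ_right_real n j
  have h2 := choose_succ_left_real (n := 2 * n + j) (k := n) (by lia)
  push_cast at h2
  rw [wt, wt, ← add_assoc]
  calc (n.choose (j + 1) : ℝ) ^ 2 * ((2 * n + j + 1).choose n) * ((j + 1) ^ 2 * (n + j + 1))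
      = (n.choose (j + 1) * (j + 1)) ^ 2 *
          ((2 * n + j + 1).choose n * (2 * n + j + 1 - n)) := by ring
    _ = _ := by rw [h1, h2]; ring

theorem wt_succ_left (n j : ℕ) :
    wt n j * ((n + 1) * ((2 * n + j + 1) * (2 * n + j + 2))) =
      wt (n + 1) j * ((n + 1 - j) ^ 2 * (n + j + 1)) := by
  rcases Nat.lt_trichotomy j (n + 1) with h | rfl | h
  · have h1 := choose_succ_left_real (n := n) (k := j) (by lia)
    have h2 := choose_succ_left_real (n := 2 * n + j) (k := n) (by lia)
    have h3 : ((2 * n + j + 1 + 1 : ℕ) : ℝ) * ((2 * n + j + 1).choose n) =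
        ((2 * n + j + 1 + 1).choose (n + 1)) * (n + 1) := by
      exact_mod_cast Nat.add_one_mul_choose_eq (2 * n + j + 1) n
    push_cast at h2 h3
    rw [wt, wt, show 2 * (n + 1) + j = 2 * n + j + 1 + 1 by ring]
    refine mul_left_cancel₀ (show (n + 1 : ℝ) ≠ 0 by positivity) ?_
    calc _ = (n.choose j * (n + 1 : ℝ)) ^ 2 * (2 * n + j + 2) *
          ((2 * n + j).choose n * (2 * n + j + 1)) := by ring
      _ = ((n + 1).choose j * (n + 1 - j : ℝ)) ^ 2 * (n + j + 1) *
          ((2 * n + j + 1 + 1) * (2 * n + j + 1).choose n) := by rw [← h1, ← h2]; ring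
      _ = _ := by rw [h3]; ring
  · rw [wt_eq_zero (Nat.lt_succ_self n)]
    push_cast
    ring
  · rw [wt_eq_zero h, wt_eq_zero (by lia)]
    ring

/-- The middle coefficient of the difference equation of `Sh n`. -/
noncomputable def recCoeff (n t : ℝ) : ℝ :=
  2 * t ^ 3 + (4 * n + 4) * t ^ 2 + (3 + 3 * n - n ^ 2) * t + 1 + 2 * n + 2 * n ^ 2 + 2 * n ^ 3

theorem Sh_rec (n : ℕ) (t : ℝ) :
    t ^ 2 * (t + 3 * n + 1) * Sh n t + (t + 1) ^ 2 * (t + n + 1) * Sh n (t + 2) =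
      recCoeff n t * Sh n (t + 1) := by
  rcases n with _ | m
  · simp [Sh, recCoeff, poch]
    ring
  set n := m + 1 with hn
  have hnr : (n : ℝ) = m + 1 := by rw [hn]; push_cast; rfl
  let H : ℕ → ℝ := fun j => -n * j ^ 2 * (n + j) * wt n j * poch (t - j + 2) m
  have key : ∀ j : ℕ, t ^ 2 * (t + 3 * n + 1) * (wt n j * poch (t - j) n) +
      (t + 1) ^ 2 * (t + n + 1) * (wt n j * poch (t + 2 - j) n) -
      recCoeff n t * (wt n j * poch (t + 1 - j) n) = H (j + 1) - H j := by
    intro j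
    have e1 : poch (t - j) n = (t - j) * poch (t - j + 1) m := poch_succ' _ _
    have e2 : poch (t + 1 - j) n = poch (t - j + 1) m * (t - j + 1 + m) := by
      rw [← poch_succ]; congr 1; ring
    have e3 : poch (t + 2 - j) n = poch (t - j + 2) m * (t - j + 2 + m) := by
      rw [← poch_succ]; congr 1; ring
    have e4 : poch (t - j + 1) m * (t - j + 1 + m) = (t - j + 1) * poch (t - j + 2) m := by
      rw [← poch_succ, poch_succ']; congr 2; ring
    have e5 : H (j + 1) = - n * poch (t - j + 1) m *
        (wt n (j + 1) * ((j + 1) ^ 2 * (n + j + 1))) := by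
      simp only [H]
      rw [show t - ((j + 1 : ℕ) : ℝ) + 2 = t - j + 1 by push_cast; ring]
      push_cast
      ring
    rw [e5, wt_succ_right, e1, e2, e3]
    simp only [H, recCoeff, hnr]
    linear_combination (-wt n j * ((t + 1) ^ 2 * (t + m + 2) +
      (m + 1) * (t + 1 + j) * (m + t + 2) + (m + 1) * j ^ 2)) * e4
  have hs := Finset.sum_range_sub H (n + 1)
  rw [← Finset.sum_congr rfl fun j _ => key j] at hs
  have h0 : H 0 = 0 := by simp [H]
  have h1 : H (n + 1) = 0 := by simp [H, wt_eq_zero (Nat.lt_succ_self n)]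
  rw [h0, h1, Finset.sum_sub_distrib, Finset.sum_add_distrib, ← Finset.mul_sum, ← Finset.mul_sum,
    ← Finset.mul_sum] at hs
  simp only [Sh]
  linarith

/-- The coefficient of `Sh n t` in the contiguous relation for `Sh (n + 1) t`. -/
noncomputable def contA (n t : ℝ) : ℝ :=
  (-6 - 27 * n - 27 * n ^ 2) * (2 * (n + 1) ^ 2 * (2 * n + 1)) +
    (20 + 145 * n + 315 * n ^ 2 + 216 * n ^ 3) * (n + 1) * t +
    (-1 - 69 * n - 213 * n ^ 2 - 171 * n ^ 3) * t ^ 2 - (33 + 105 * n + 85 * n ^ 2) * t ^ 3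

/-- The coefficient of `t² Sh n (t + 1)` in the contiguous relation for `Sh (n + 1) t`. -/
noncomputable def contB (n t : ℝ) : ℝ :=
  (1 + 36 * n + 108 * n ^ 2 + 86 * n ^ 3) + (33 + 105 * n + 85 * n ^ 2) * t

theorem Sh_contiguous (n : ℕ) (t : ℝ) :
    4 * (n + 1) ^ 2 * (2 * n + 1) ^ 2 * Sh (n + 1) t =
      contA n t * Sh n t + t ^ 2 * contB n t * Sh n (t + 1) := by
  let β : ℕ → ℝ := fun j => (n + 1) * wt (n + 1) j / ((2 * n + j + 1) * (2 * n + j + 2))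
  let h0 : ℝ → ℝ := fun j => (n + 1) ^ 2 * (1 + 36 * n + 108 * n ^ 2 + 86 * n ^ 3) +
    (n + 1) * (30 + 107 * n + 116 * n ^ 2 + 32 * n ^ 3) * j -
    (n + 1) * (19 + 58 * n + 46 * n ^ 2) * j ^ 2
  let h1 : ℝ → ℝ := fun j => (n + 1) * (1 - 41 * n - 142 * n ^ 2 - 119 * n ^ 3) +
    (-46 - 163 * n - 168 * n ^ 2 - 38 * n ^ 3) * j + (33 + 105 * n + 85 * n ^ 2) * j ^ 2
  let H : ℕ → ℝ := fun j =>
    (h0 j + t * h1 j) * (j ^ 2 * (n + j + 1) * β j) * poch (t - j + 1) n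
  have hβ1 : ∀ j, (n + 1 : ℝ) * wt (n + 1) j = β j * ((2 * n + j + 1) * (2 * n + j + 2)) := by
    intro j
    simp only [β]
    field_simp
  have hβ2 : ∀ j, (n + 1 : ℝ) ^ 2 * wt n j = β j * ((n + 1 - j) ^ 2 * (n + j + 1)) := by
    intro j
    have := wt_succ_left n j
    simp only [β]
    field_simp
    linear_combination this
  have hβ3 : ∀ j, ((j + 1) ^ 2 * (n + j + 2)) * β (j + 1) =
      β j * ((n + 1 - j) ^ 2 * (2 * n + j + 1)) := by
    intro j
    have := wt_succ_right (n + 1) j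
    simp only [β]
    push_cast at this ⊢
    field_simp
    linear_combination (2 * n + j + 2 : ℝ) * this
  have key : ∀ j : ℕ, 4 * (n + 1) ^ 4 * (2 * n + 1) ^ 2 * (wt (n + 1) j * poch (t - j) (n + 1)) -
      (n + 1) ^ 2 * contA n t * (wt n j * poch (t - j) n) -
      (n + 1) ^ 2 * (t ^ 2 * contB n t) * (wt n j * poch (t + 1 - j) n) = H (j + 1) - H j := by
    intro j
    have e1 : poch (t - j) (n + 1) = (t - j) * poch (t - j + 1) n := poch_succ' _ _
    have e2 : poch (t - j) n * (t - j + n) = (t - j) * poch (t - j + 1) n := by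
      rw [← poch_succ, poch_succ']
    have e3 : poch (t + 1 - j) n = poch (t - j + 1) n := by congr 1; ring
    have e4 : H (j + 1) = (h0 (j + 1) + t * h1 (j + 1)) * poch (t - j) n *
        (((j + 1) ^ 2 * (n + j + 2)) * β (j + 1)) := by
      simp only [H]
      rw [show t - ((j + 1 : ℕ) : ℝ) + 1 = t - j by push_cast; ring]
      push_cast
      ring
    rw [e4, hβ3, e1, e3]
    have a1 := hβ1 j
    have a2 := hβ2 j
    simp only [H, h0, h1]
    clear_value β
    generalize poch (t - j + 1) n = x at e2 ⊢
    generalize poch (t - j) n = y at e2 ⊢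
    generalize wt (n + 1) j = w1 at a1 ⊢
    generalize wt n j = w0 at a2 ⊢
    generalize β j = b at a1 a2 ⊢
    linear_combination (norm := (simp only [contA, contB]; ring1))
      (4 * (n + 1) ^ 3 * (2 * n + 1) ^ 2 * (t - j) * x) * a1 -
      (contA n t * y + t ^ 2 * contB n t * x) * a2 -
      b * (4 * (n + 1) ^ 3 * (2 * n + 1) ^ 2 * ((2 * n + j + 1) * (2 * n + j + 2)) +
        (n + j + 1) * (-(33 + 105 * n + 85 * n ^ 2) * (n + 1 - j) ^ 2 * (t ^ 2 + j * t + j ^ 2) -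
          (1 + 36 * n + 108 * n ^ 2 + 86 * n ^ 3) * (n + 1 - j) ^ 2 * (t + j) +
          ((n + 1) * (1 - 41 * n - 142 * n ^ 2 - 119 * n ^ 3) +
          (-46 - 163 * n - 168 * n ^ 2 - 38 * n ^ 3) * j + (33 + 105 * n + 85 * n ^ 2) * j ^ 2) *
          j ^ 2)) * e2
  have hs := Finset.sum_range_sub H (n + 2)
  rw [← Finset.sum_congr rfl fun j _ => key j] at hs
  have h2 : H 0 = 0 := by simp [H]
  have h3 : H (n + 2) = 0 := by simp [H, β, wt_eq_zero (show n + 1 < n + 2 by lia)]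
  rw [h2, h3, Finset.sum_sub_distrib, Finset.sum_sub_distrib, ← Finset.mul_sum,
    ← Finset.mul_sum, ← Finset.mul_sum, Finset.sum_range_succ (fun j => wt n j * _) (n + 1),
    Finset.sum_range_succ (fun j => wt n j * _) (n + 1), wt_eq_zero (Nat.lt_succ_self n)] at hs
  have hn : ((n : ℝ) + 1) ^ 2 ≠ 0 := by positivity
  refine mul_left_cancel₀ hn ?_
  simp only [Sh]
  linear_combination hs

theorem R_zero_eq (n : ℕ) {t : ℝ} (ht : 0 < t) :
    R n 0 t = (n.factorial : ℝ) ^ 2 / (2 * n).factorial * ((t + n / 2) * poch (t - 2 * n) (2 * n) *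
      poch (t + n + 1) (2 * n) * (poch t (n + 1))⁻¹ ^ 4) := by
  have h1 := (poch_pos ht (n + 1)).ne'
  have h2 := (poch_pos (show 0 < t + n + 1 by positivity) n).ne'
  have h3 : poch t (2 * n + 1) = poch t (n + 1) * poch (t + n + 1) n := by
    rw [show 2 * n + 1 = (n + 1) + n by ring, poch_add]
    push_cast
    rw [add_assoc]
  simp only [R, poch_zero, Nat.sub_zero, Nat.cast_zero, add_zero, pow_zero, Nat.factorial_zero,
    Nat.cast_one, h3]
  field_simp

/-- The certificate factor for the left-hand series. -/
noncomputable def certL (n t : ℝ) : ℝ :=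
  (2 * (6 + 61 * n + 254 * n ^ 2 + 552 * n ^ 3 + 620 * n ^ 4 + 283 * n ^ 5) +
    t * ((44 + 387 * n + 1339 * n ^ 2 + 2045 * n ^ 3 + 1145 * n ^ 4) +
    t * ((4 * n + 1) * (77 + 250 * n + 205 * n ^ 2) + t * (77 + 250 * n + 205 * n ^ 2)))) *
    (4 * (n + 1) ^ 4 * (2 * n + 1))⁻¹

/-- The telescoping companion of `R n 0`. -/
noncomputable def compL (n : ℕ) (t : ℝ) : ℝ :=
  (n.factorial : ℝ) ^ 2 / (2 * n).factorial * (certL n t * poch (t - 2 * n - 1) (2 * n + 1) *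
    poch (t + n + 1) (2 * n) * (poch t (n + 1))⁻¹ ^ 4)

/-- The multiplier `-(2(2n+1)/(n+1))⁴`. -/
noncomputable def mult (n : ℝ) : ℝ := -(2 * (2 * n + 1) / (n + 1)) ^ 4

theorem R_telescope (n : ℕ) (t : ℝ) (ht : 0 < t) :
    R (n + 1) 0 t - mult n * R n 0 t = compL n (t + 1) - compL n t := by
  rw [R_zero_eq _ ht, R_zero_eq _ ht]
  have hv := (poch_pos ht (n + 1)).ne'
  have htn : t + n + 1 ≠ 0 := by positivity
  have e1 : poch (t - 2 * (n + 1 : ℕ)) (2 * (n + 1)) =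
      (t - 2 * n - 2) * ((t - 2 * n - 1) * poch (t - 2 * n) (2 * n)) := by
    rw [show 2 * (n + 1) = (2 * n + 1) + 1 by ring, poch_succ', poch_succ']
    push_cast
    ring_nf
  have e2 : poch (t + (n + 1 : ℕ) + 1) (2 * (n + 1)) =
      poch (t + n + 1) (2 * n) * (t + 3 * n + 1) * (t + 3 * n + 2) * (t + 3 * n + 3) /
        (t + n + 1) := by
    rw [eq_div_iff htn, mul_comm]
    have := poch_succ' (t + n + 1) (2 * (n + 1))
    rw [show 2 * (n + 1) + 1 = 2 * n + 1 + 1 + 1 by ring, poch_succ, poch_succ, poch_succ,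
      show 2 * n + 1 + 1 = 2 * (n + 1) by ring] at this
    push_cast at this ⊢
    rw [show t + (n + 1 : ℝ) + 1 = t + n + 1 + 1 by ring, ← this]
    ring
  have e3 : poch t (n + 1 + 1) = poch t (n + 1) * (t + n + 1) := by
    rw [poch_succ]; push_cast; ring
  have e4 : poch (t - 2 * n - 1) (2 * n + 1) = (t - 2 * n - 1) * poch (t - 2 * n) (2 * n) := by
    rw [poch_succ']; ring_nf
  have e5 : poch (t + 1 - 2 * n - 1) (2 * n + 1) = poch (t - 2 * n) (2 * n) * t := by
    rw [show t + 1 - 2 * n - 1 = t - 2 * n by ring, poch_succ]; push_cast; ring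
  have e6 : poch (t + 1 + n + 1) (2 * n) =
      poch (t + n + 1) (2 * n) * (t + 3 * n + 1) / (t + n + 1) := by
    rw [eq_div_iff htn, mul_comm]
    have := poch_succ' (t + n + 1) (2 * n)
    rw [poch_succ] at this
    push_cast at this
    rw [show t + 1 + (n : ℝ) + 1 = t + n + 1 + 1 by ring, ← this]
    ring
  have e7 : poch (t + 1) (n + 1) = poch t (n + 1) * (t + n + 1) / t := by
    rw [eq_div_iff ht.ne', mul_comm, ← poch_succ', e3]
  rw [compL, compL, e1, e2, e3, e4, e5, e6, e7]
  generalize poch t (n + 1) = v at *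
  generalize poch (t - 2 * n) (2 * n) = p
  generalize poch (t + n + 1) (2 * n) = q
  have e8 : ((2 * (n + 1)).factorial : ℝ) = 2 * (n + 1) * ((2 * n + 1) * (2 * n).factorial) := by
    rw [show 2 * (n + 1) = 2 * n + 1 + 1 by ring, Nat.factorial_succ, Nat.factorial_succ]
    push_cast
    ring
  rw [e8, Nat.factorial_succ]
  have f1 : ((2 * n).factorial : ℝ) ≠ 0 := by positivity
  simp only [certL, mult]
  push_cast
  generalize ((2 * n).factorial : ℝ) = f at *
  generalize (n.factorial : ℝ) = g at *
  have g1 : (n : ℝ) + 1 ≠ 0 := by positivity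
  have g2 : 2 * (n : ℝ) + 1 ≠ 0 := by positivity
  generalize (n : ℝ) = N at *
  have g4 : t ≠ 0 := ht.ne'
  clear e1 e2 e3 e4 e5 e6 e7 e8
  field_simp
  ring

theorem ratDecay_R (n : ℕ) : RatDecay 3 (R n 0) := by
  have h := (((((RatDecay.linear (n / 2 : ℝ)).mul (RatDecay.poch (-(2 * n)) (2 * n))).mul
    (RatDecay.poch (n + 1) (2 * n))).mul
    ((RatDecay.inv_poch le_rfl (n + 1)).pow 4)).const_mul
    ((n.factorial : ℝ) ^ 2 / (2 * n).factorial)).mono (l := 3) (by push_cast; lia)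
  refine h.congr fun t ht => ?_
  rw [R_zero_eq n ht]
  simp only [add_zero, ← sub_eq_add_neg, ← add_assoc]

theorem ratDecay_certL (n : ℝ) : RatDecay (-3) (certL n) := by
  have h := ((((RatDecay.const (77 + 250 * n + 205 * n ^ 2)).horner
    ((4 * n + 1) * (77 + 250 * n + 205 * n ^ 2)) (by lia)).horner
    (44 + 387 * n + 1339 * n ^ 2 + 2045 * n ^ 3 + 1145 * n ^ 4) (by lia)).horner
    (2 * (6 + 61 * n + 254 * n ^ 2 + 552 * n ^ 3 + 620 * n ^ 4 + 283 * n ^ 5)) (by lia)).mul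
    (RatDecay.const (4 * (n + 1) ^ 4 * (2 * n + 1))⁻¹)
  exact h.mono (by lia)

theorem ratDecay_compL (n : ℕ) : RatDecay 0 (compL n) := by
  have h := (((((ratDecay_certL n).mul (RatDecay.poch (-(2 * n) - 1) (2 * n + 1))).mul
    (RatDecay.poch (n + 1) (2 * n))).mul
    ((RatDecay.inv_poch le_rfl (n + 1)).pow 4)).const_mul
    ((n.factorial : ℝ) ^ 2 / (2 * n).factorial)).mono (l := 0) (by push_cast; lia)
  refine h.congr fun t ht => ?_
  rw [compL]
  simp only [add_zero, sub_eq_add_neg, ← add_assoc]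

/-- The boundary term produced by telescoping the left-hand series. -/
noncomputable def bdry (n : ℕ) : ℝ :=
  (1 / 3) * (deriv (compL n) (n + 1) + deriv (R (n + 1) 0) (n + 1))

theorem Zl_succ (n : ℕ) : Zl (n + 1) 0 = mult n * Zl n 0 + bdry n := by
  have hpos : (0 : ℝ) < n + 1 := by positivity
  have s0 := (ratDecay_R n).deriv.summable (by lia) hpos
  have s1 := (ratDecay_R (n + 1)).deriv.summable (by lia) hpos
  have hd : ∀ t : ℝ, 0 < t → deriv (R (n + 1) 0) t - mult n * deriv (R n 0) t =
      deriv (compL n) (t + 1) - deriv (compL n) t := by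
    intro t ht
    rw [← deriv_telescope (ratDecay_compL n) (R_telescope n) t ht,
      deriv_fun_sub ((ratDecay_R (n + 1)).differentiableAt ht)
        (((ratDecay_R n).differentiableAt ht).const_mul _),
      deriv_const_mul _ ((ratDecay_R n).differentiableAt ht)]
  have hs := tsum_telescope (f := fun t => deriv (R (n + 1) 0) t - mult n * deriv (R n 0) t)
    (a := n + 1) ((ratDecay_compL n).deriv.tendsto (by lia))
    (fun ν => hd _ (by positivity)) (s1.sub (s0.mul_left _))
  rw [Summable.tsum_sub s1 (s0.mul_left _), tsum_mul_left, s1.tsum_eq_zero_add] at hs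
  simp only [Nat.cast_zero, add_zero] at hs
  have e : ∀ ν : ℕ, ((n + 1 : ℕ) : ℝ) - (0 : ℕ) + 1 + ν = n + 1 + ((ν + 1 : ℕ) : ℝ) := by
    intro ν; push_cast; ring
  simp only [Zl, bdry, e]
  simp only [Nat.cast_zero, sub_zero]
  linear_combination (-1 / 3 : ℝ) * hs

theorem deriv_of_simple_zero {f g : ℝ → ℝ} {a : ℝ} (hf : ∀ t, 0 < t → f t = (t - a) * g t)
    (ha : 0 < a) (hg : DifferentiableAt ℝ g a) : deriv f a = g a := by
  have : f =ᶠ[nhds a] fun t => (t - a) * g t := by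
    filter_upwards [lt_mem_nhds ha] with x hx using hf x hx
  rw [this.deriv_eq]
  have h := ((hasDerivAt_id a).sub_const a).fun_mul hg.hasDerivAt
  simpa using h.deriv

theorem poch_nat (a k : ℕ) : poch (a + 1) k * a.factorial = (a + k).factorial := by
  induction k with
  | zero => simp [poch_zero]
  | succ k ih =>
    rw [poch_succ, ← add_assoc a k 1, Nat.factorial_succ, Nat.cast_mul, ← ih]
    push_cast
    ring

theorem poch_neg_nat (k : ℕ) : poch (-k) k = (-1) ^ k * k.factorial := by
  induction k with
  | zero => simp [poch_zero]
  | succ k ih =>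
    rw [poch_succ', Nat.factorial_succ, show -((k + 1 : ℕ) : ℝ) + 1 = -k by push_cast; ring, ih]
    push_cast
    ring

theorem deriv_compL (n : ℕ) : deriv (compL n) (n + 1) = (n.factorial : ℝ) ^ 2 / (2 * n).factorial *
    (certL n (n + 1) * ((-1) ^ n * n.factorial * n.factorial) *
      ((4 * n + 1).factorial / (2 * n + 1).factorial) *
      (n.factorial / (2 * n + 1).factorial) ^ 4) := by
  have hpos : (0 : ℝ) < n + 1 := by positivity
  let g : ℝ → ℝ := fun t => (n.factorial : ℝ) ^ 2 / (2 * n).factorial *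
    (certL n t * (poch (t + (-2 * n - 1)) n * poch (t + -n) n) *
      poch (t + (n + 1)) (2 * n) * (poch (t + 0) (n + 1))⁻¹ ^ 4)
  have hg := ((((ratDecay_certL n).mul ((RatDecay.poch (-2 * n - 1) n).mul
    (RatDecay.poch (-n) n))).mul (RatDecay.poch (n + 1) (2 * n))).mul
    ((RatDecay.inv_poch le_rfl (n + 1)).pow 4)).const_mul
    ((n.factorial : ℝ) ^ 2 / (2 * n).factorial)
  rw [deriv_of_simple_zero (g := g) (fun t ht => ?_) hpos (hg.differentiableAt hpos)]
  · simp only [g]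
    rw [show (n : ℝ) + 1 + (-2 * n - 1) = -n by ring, poch_neg_nat,
      show (n : ℝ) + 1 + -n = (0 : ℕ) + 1 by push_cast; ring,
      show (n : ℝ) + 1 + (n + 1) = (2 * n + 1 : ℕ) + 1 by push_cast; ring, add_zero]
    have a1 := poch_nat 0 n
    have a2 := poch_nat (2 * n + 1) (2 * n)
    have a3 := poch_nat n (n + 1)
    have p1 : ((2 * n + 1).factorial : ℝ) ≠ 0 := by positivity
    have p2 : (n.factorial : ℝ) ≠ 0 := by positivity
    rw [Nat.factorial_zero, Nat.cast_one, mul_one, zero_add] at a1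
    rw [a1, eq_div_of_mul_eq p1 a2, eq_div_of_mul_eq p2 a3, inv_div,
      show 2 * n + 1 + 2 * n = 4 * n + 1 by ring, show n + (n + 1) = 2 * n + 1 by ring]
  · simp only [g, compL]
    rw [show 2 * n + 1 = n + (1 + n) by ring, poch_add, poch_add,
      show t + (-2 * (n : ℝ) - 1) = t - 2 * n - 1 by ring,
      show t - 2 * (n : ℝ) - 1 + n + (1 : ℕ) = t + -n by push_cast; ring, add_zero, ← add_assoc]
    simp only [poch, Finset.prod_range_one, Nat.cast_zero]
    ring

theorem deriv_R_succ (n : ℕ) : deriv (R (n + 1) 0) (n + 1) =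
    ((n + 1).factorial : ℝ) ^ 2 / (2 * (n + 1)).factorial *
    (3 * (n + 1) / 2 * ((-1) ^ (n + 1) * (n + 1).factorial * n.factorial) *
      ((4 * n + 4).factorial / (2 * n + 2).factorial) *
      (n.factorial / (2 * n + 2).factorial) ^ 4) := by
  have hpos : (0 : ℝ) < n + 1 := by positivity
  let g : ℝ → ℝ := fun t => ((n + 1).factorial : ℝ) ^ 2 / (2 * (n + 1)).factorial *
    ((t + (n + 1 : ℕ) / 2) * (poch (t + (-2 * n - 2)) (n + 1) * poch (t + -n) n) *
      poch (t + (n + 2)) (2 * (n + 1)) * (poch (t + 0) (n + 1 + 1))⁻¹ ^ 4)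
  have hg := ((((RatDecay.linear ((n + 1 : ℕ) / 2 : ℝ)).mul
    ((RatDecay.poch (-2 * n - 2) (n + 1)).mul (RatDecay.poch (-n) n))).mul (RatDecay.poch (n + 2) (2 * (n + 1)))).mul
    ((RatDecay.inv_poch le_rfl (n + 1 + 1)).pow 4)).const_mul
    (((n + 1).factorial : ℝ) ^ 2 / (2 * (n + 1)).factorial)
  rw [deriv_of_simple_zero (g := g) (fun t ht => ?_) hpos (hg.differentiableAt hpos)]
  · simp only [g]
    rw [show (n : ℝ) + 1 + (-2 * n - 2) = -(n + 1 : ℕ) by push_cast; ring, poch_neg_nat,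
      show (n : ℝ) + 1 + -n = (0 : ℕ) + 1 by push_cast; ring,
      show (n : ℝ) + 1 + (n + 2) = (2 * n + 2 : ℕ) + 1 by push_cast; ring, add_zero]
    have a1 := poch_nat 0 n
    have a2 := poch_nat (2 * n + 2) (2 * (n + 1))
    have a3 := poch_nat n (n + 1 + 1)
    have p1 : ((2 * n + 2).factorial : ℝ) ≠ 0 := by positivity
    have p2 : (n.factorial : ℝ) ≠ 0 := by positivity
    rw [Nat.factorial_zero, Nat.cast_one, mul_one, zero_add] at a1
    rw [a1, eq_div_of_mul_eq p1 a2, eq_div_of_mul_eq p2 a3, inv_div,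
      show 2 * n + 2 + 2 * (n + 1) = 4 * n + 4 by ring, show n + (n + 1 + 1) = 2 * n + 2 by ring]
    push_cast
    ring
  · rw [R_zero_eq _ ht]
    simp only [g]
    rw [show (2 * (n + 1) : ℕ) = (n + 1) + (1 + n) by ring, poch_add (t - _),
      poch_add (_ - _ + _) 1,
      show t + (-2 * (n : ℝ) - 2) = t - 2 * ((n + 1 : ℕ) : ℝ) by push_cast; ring,
      show t - 2 * ((n + 1 : ℕ) : ℝ) + (n + 1 : ℕ) + (1 : ℕ) = t + -n by push_cast; ring, add_zero,
      show t + ((n : ℝ) + 2) = t + (n + 1 : ℕ) + 1 by push_cast; ring]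
    simp only [poch, Finset.prod_range_one, Nat.cast_zero]
    push_cast
    ring

/-- The quartic factor of the boundary terms. -/
noncomputable def quart (n : ℝ) : ℝ :=
  831 + 5265 * n + 12601 * n ^ 2 + 13499 * n ^ 3 + 5460 * n ^ 4

theorem bdry_eq (n : ℕ) : bdry n = (-1) ^ n * (n.factorial ^ 8 * (4 * n + 1).factorial * quart n) /
    (48 * ((2 * n).factorial * (2 * n + 1).factorial ^ 5 * (n + 1) ^ 4)) := by
  rw [bdry, deriv_compL, deriv_R_succ, show 2 * (n + 1) = 2 * n + 1 + 1 by ring,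
    show 2 * n + 2 = 2 * n + 1 + 1 by ring, show 4 * n + 4 = 4 * n + 1 + 1 + 1 + 1 by ring]
  simp only [Nat.factorial_succ, certL, quart, pow_succ (-1 : ℝ) n]
  push_cast
  have f1 : ((2 * n).factorial : ℝ) ≠ 0 := by positivity
  generalize ((2 * n).factorial : ℝ) = f at *
  generalize (n.factorial : ℝ) = g at *
  generalize ((4 * n).factorial : ℝ) = h at *
  generalize (-1 : ℝ) ^ n = e
  have g1 : (n : ℝ) + 1 ≠ 0 := by positivity
  have g2 : 2 * (n : ℝ) + 1 ≠ 0 := by positivity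
  generalize (n : ℝ) = N at *
  rw [show 2 * N + 1 + 1 = 2 * (N + 1) by ring]
  field_simp
  ring

/-- The ratio of consecutive boundary terms, up to sign. -/
noncomputable def rho (n : ℝ) : ℝ :=
  (n + 1) ^ 7 * (4 * n + 3) * (4 * n + 5) * quart (n + 1) /
    (8 * (n + 2) ^ 4 * (2 * n + 3) ^ 5 * quart n)

theorem quart_pos (n : ℕ) : 0 < quart n := by
  rw [quart]
  positivity

theorem bdry_succ (n : ℕ) : bdry (n + 1) = - rho n * bdry n := by
  rw [bdry_eq, bdry_eq, rho, show 2 * (n + 1) = 2 * n + 1 + 1 by ring,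
    show 4 * (n + 1) + 1 = 4 * n + 1 + 1 + 1 + 1 + 1 by ring]
  simp only [Nat.factorial_succ, pow_succ (-1 : ℝ) n]
  push_cast
  have f1 : ((2 * n).factorial : ℝ) ≠ 0 := by positivity
  have hq := (quart_pos n).ne'
  generalize ((2 * n).factorial : ℝ) = f at *
  generalize (n.factorial : ℝ) = g at *
  generalize ((4 * n).factorial : ℝ) = h at *
  generalize (-1 : ℝ) ^ n = e
  have g1 : (n : ℝ) + 1 ≠ 0 := by positivity
  have g2 : 2 * (n : ℝ) + 1 ≠ 0 := by positivity
  have g3 : 2 * (n : ℝ) + 3 ≠ 0 := by positivity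
  have g4 : (n : ℝ) + 2 ≠ 0 := by positivity
  generalize (n : ℝ) = N at *
  generalize quart N = q at *
  generalize quart (N + 1) = q' at *
  rw [show 2 * N + 2 + 1 = 2 * N + 3 by ring, show 2 * N + 1 + 1 = 2 * (N + 1) by ring,
    show N + 1 + 1 = N + 2 by ring]
  obtain ⟨x, hx⟩ : ∃ x, 2 * N + 1 = x := ⟨_, rfl⟩
  obtain ⟨y, hy⟩ : ∃ y, 2 * N + 3 = y := ⟨_, rfl⟩
  rw [hx] at g2 ⊢
  rw [hy] at g3 ⊢
  field_simp
  rw [← hx]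
  ring

/-- The top coefficient shared by `certRA` and `certRB`. -/
noncomputable def certTop (n : ℝ) : ℝ :=
  13641896448 + 193335771111 * n + 1247811980537 * n ^ 2 + 4852225695691 * n ^ 3 +
  12674174325403 * n ^ 4 + 23468714382746 * n ^ 5 + 31680768036086 * n ^ 6 +
  31559426251337 * n ^ 7 + 23199134404289 * n ^ 8 + 12430648402607 * n ^ 9 +
  4720611594861 * n ^ 10 + 1203692510964 * n ^ 11 + 184813471744 * n ^ 12 + 12912332160 * n ^ 13

/-- The coefficient of `Sh n t` in the right-hand certificate. -/
noncomputable def certRA (n t : ℝ) : ℝ :=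
  (216898560 + 74950233408 * n + 1008426980304 * n ^ 2 + 6023718148486 * n ^ 3 +
  19949836055571 * n ^ 4 + 34898213526370 * n ^ 5 + 3039191401594 * n ^ 6 -
  162208056736088 * n ^ 7 - 511921765700020 * n ^ 8 - 965817808198524 * n ^ 9 -
  1323486936707130 * n ^ 10 - 1408032351727814 * n ^ 11 - 1199538302653239 * n ^ 12 -
  828951580090766 * n ^ 13 - 464361476420024 * n ^ 14 - 208121397087488 * n ^ 15 -
  72744029330048 * n ^ 16 - 19036425546752 * n ^ 17 - 3494274673920 * n ^ 18 -
  399761971200 * n ^ 19 - 21385728000 * n ^ 20) +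
  t * (
  (74766139776 + 749578340544 * n + 2025066468656 * n ^ 2 - 7838709155483 * n ^ 3 -
  81253861416096 * n ^ 4 - 324536612322633 * n ^ 5 - 825591633454797 * n ^ 6 -
  1521637049023793 * n ^ 7 - 2182116445225763 * n ^ 8 - 2575534257866003 * n ^ 9 -
  2614108377668723 * n ^ 10 - 2324081930756396 * n ^ 11 - 1783844897017325 * n ^ 12 -
  1140051057217964 * n ^ 13 - 581988343617280 * n ^ 14 - 227759337768576 * n ^ 15 -
  65262886662528 * n ^ 16 - 12835936512000 * n ^ 17 - 1544241715200 * n ^ 18 -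
  85542912000 * n ^ 19) +
  t * (
  (-292598565840 - 4066164996078 * n - 25124473637779 * n ^ 2 - 90012637699146 * n ^ 3 -
  203375995686115 * n ^ 4 - 293233732058350 * n ^ 5 - 264871620990531 * n ^ 6 -
  201201694511384 * n ^ 7 - 403005363796115 * n ^ 8 - 1020541809691852 * n ^ 9 -
  1714624950477502 * n ^ 10 - 1942781507770930 * n ^ 11 - 1556626963390022 * n ^ 12 -
  900812245198228 * n ^ 13 - 376089545171824 * n ^ 14 - 110765688816192 * n ^ 15 -
  21857430532480 * n ^ 16 - 2593139543040 * n ^ 17 - 139678156800 * n ^ 18) +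
  t * (
  (319624117128 + 4888416806331 * n + 33701131302320 * n ^ 2 + 137044823126409 * n ^ 3 +
  358102813444780 * n ^ 4 + 598737639886170 * n ^ 5 + 531275642341863 * n ^ 6 -
  162847560900861 * n ^ 7 - 1326607388767930 * n ^ 8 - 2270392057962761 * n ^ 9 -
  2393717979329463 * n ^ 10 - 1764088421368352 * n ^ 11 - 936904584368658 * n ^ 12 -
  357122120594704 * n ^ 13 - 94858799868704 * n ^ 14 - 16494467936320 * n ^ 15 -
  1653712320000 * n ^ 16 - 69503616000 * n ^ 17) +
  t * (
  (-69372597744 - 1470783572892 * n - 13613259269385 * n ^ 2 - 74242352164996 * n ^ 3 -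
  269197168121524 * n ^ 4 - 690632626029182 * n ^ 5 - 1297730052870327 * n ^ 6 -
  1818485746359854 * n ^ 7 - 1911221143680469 * n ^ 8 - 1497290866647036 * n ^ 9 -
  855424889738692 * n ^ 10 - 338564679576058 * n ^ 11 - 80982733821643 * n ^ 12 -
  5339367473294 * n ^ 13 + 3068523966904 * n ^ 14 + 945988639808 * n ^ 15 + 89662110720 * n ^ 16) +
  t * (
  (-89178177960 - 1301204701098 * n - 8536299582165 * n ^ 2 - 33008592925845 * n ^ 3 -
  82407896620279 * n ^ 4 - 134731113521167 * n ^ 5 - 131908372259744 * n ^ 6 -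
  34832146278911 * n ^ 7 + 110509331912548 * n ^ 8 + 202466865589033 * n ^ 9 +
  190373183209657 * n ^ 10 + 115991140989000 * n ^ 11 + 47444178395767 * n ^ 12 +
  12656632743740 * n ^ 13 + 1998770954976 * n ^ 14 + 142133322240 * n ^ 15) +
  t * (
  (10643010336 + 226040875122 * n + 2039651814136 * n ^ 2 + 10668555048716 * n ^ 3 +
  36660545845996 * n ^ 4 + 88259060281326 * n ^ 5 + 154274861635440 * n ^ 6 +
  199557694173026 * n ^ 7 + 192406107844404 * n ^ 8 + 137858492572664 * n ^ 9 +
  72368925594336 * n ^ 10 + 27028318270970 * n ^ 11 + 6797889198488 * n ^ 12 +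
  1031868099552 * n ^ 13 + 71402647680 * n ^ 14) +
  t * certTop n))))))

/-- The coefficient of `Sh n (t - 1)` in the right-hand certificate, up to elementary factors. -/
noncomputable def certRB (n t : ℝ) : ℝ :=
  (-2232150048 - 229192212816 * n - 3390698018286 * n ^ 2 - 24593334681721 * n ^ 3 -
  111293309189223 * n ^ 4 - 348467240037089 * n ^ 5 - 797883490564403 * n ^ 6 -
  1380062687939067 * n ^ 7 - 1838231401324131 * n ^ 8 - 1905180657096801 * n ^ 9 -
  1541545636993611 * n ^ 10 - 970706652235780 * n ^ 11 - 470822053196646 * n ^ 12 -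
  172495431032902 * n ^ 13 - 46164900614532 * n ^ 14 - 8514967167600 * n ^ 15 -
  967473755264 * n ^ 16 - 51033615360 * n ^ 17) +
  t * (
  (-195751157328 - 3193754823870 * n - 24130785379286 * n ^ 2 - 112021852228270 * n ^ 3 -
  357467235336641 * n ^ 4 - 831116414725416 * n ^ 5 - 1455967862899010 * n ^ 6 -
  1959918380532494 * n ^ 7 - 2048529536085922 * n ^ 8 - 1667888475356286 * n ^ 9 -
  1054257608758680 * n ^ 10 - 511898504123852 * n ^ 11 - 187174187665933 * n ^ 12 -
  49822451122436 * n ^ 13 - 9104389786624 * n ^ 14 - 1020348322688 * n ^ 15 -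
  52824145920 * n ^ 16) +
  t * (
  (-35241054480 - 490950286629 * n - 3070069560773 * n ^ 2 - 11290317646273 * n ^ 3 -
  26706213182322 * n ^ 4 - 41029500428586 * n ^ 5 - 36687466912306 * n ^ 6 - 5312221357843 * n ^ 7 +
  35894491459307 * n ^ 8 + 58138813977203 * n ^ 9 + 51217084611715 * n ^ 10 +
  29634130681564 * n ^ 11 + 11581430720547 * n ^ 12 + 2963392534284 * n ^ 13 +
  450206545952 * n ^ 14 + 30875470080 * n ^ 15) +
  t * (
  (37926803232 + 585428624448 * n + 4148604232988 * n ^ 2 + 17877382479024 * n ^ 3 +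
  52304443105420 * n ^ 4 + 109848140396012 * n ^ 5 + 170698968942120 * n ^ 6 +
  199315010603528 * n ^ 7 + 175685524150308 * n ^ 8 + 116321520569300 * n ^ 9 +
  56948851978844 * n ^ 10 + 19994480103176 * n ^ 11 + 4760131120048 * n ^ 12 +
  688065820384 * n ^ 13 + 45577983360 * n ^ 14) +
  t * certTop n)))

theorem cert_left (n t : ℝ) :
    2 * (n + 2) ^ 2 * (2 * n + 3) ^ 3 * quart n * ((t - n - 2) * (t - n - 1) * (t + n)) *
        ((t + n + 1) * contA (n + 1) t * contA n t -
          t ^ 4 * (t + 3 * n + 1) * contB (n + 1) t * contB n (t + 1)) +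
      ((n + 1) ^ 7 * (4 * n + 3) * (4 * n + 5) * quart (n + 1) +
        128 * (2 * n + 3) ^ 9 * quart n) *
        ((t - n - 1) * (t + n) * (t + n + 2) * (t + 2 * n + 3) * (t + 2 * n + 4)) * contA n t +
      64 * (n + 1) ^ 5 * (4 * n + 3) * (4 * n + 5) * (2 * n + 1) ^ 6 * quart (n + 1) *
        ((t + n + 1) * (t + n + 2) *
          ((t + 2 * n + 1) * (t + 2 * n + 2) * (t + 2 * n + 3) * (t + 2 * n + 4))) =
    -(t ^ 4 * (t + n) * (t + 1 + 3 * n) * certRB n (t + 1)) -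
      (t - n - 1) * (t + n + 2) * (t + 2 * n + 4) *
        (certRA n t - certRB n t * recCoeff n (t - 1)) := by
  simp only [quart, contA, contB, certRA, certRB, recCoeff, certTop]
  ring

theorem cert_right (n t : ℝ) :
    2 * (n + 2) ^ 2 * (2 * n + 3) ^ 3 * quart n * ((t - n - 2) * (t - n - 1) * (t + n)) *
        ((t + n + 1) * contA (n + 1) t * contB n t +
          contB (n + 1) t * ((t + n + 1) * contA n (t + 1) + contB n (t + 1) * recCoeff n t)) +
      ((n + 1) ^ 7 * (4 * n + 3) * (4 * n + 5) * quart (n + 1) +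
        128 * (2 * n + 3) ^ 9 * quart n) *
        ((t - n - 1) * (t + n) * (t + n + 2) * (t + 2 * n + 3) * (t + 2 * n + 4)) * contB n t =
    (t + n) * certRA n (t + 1) -
      (t - n - 1) * (t + n + 2) * (t + 2 * n + 4) * ((t + n) * certRB n t) := by
  simp only [quart, contA, contB, certRA, certRB, recCoeff, certTop]
  ring

theorem Rtilde_zero_eq (n : ℕ) {t : ℝ} (ht : 0 < t) :
    Rtilde n 0 t = poch (t - n) n * Sh n t / ((t + n) * poch t (2 * n + 1)) := by
  have h1 := (poch_pos ht n).ne'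
  have h2 := (poch_pos ht (2 * n + 1)).ne'
  have h3 : t + n ≠ 0 := by positivity
  have h4 : (n.factorial : ℝ) ≠ 0 := by positivity
  have e1 : poch (t - n) (2 * n) = poch (t - n) n * poch t n := by
    rw [two_mul, poch_add, sub_add_cancel]
  have e2 : ∑ j ∈ Finset.range (n + 1),
      (n.choose j : ℝ) ^ 2 * ((2 * n + j).choose n : ℝ) * poch (t - j) n / n.factorial =
      Sh n t / n.factorial := by
    simp only [Sh, wt, Finset.sum_div]
  simp only [Rtilde, Nat.sub_zero]
  rw [e1, e2, poch_succ t n]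
  field_simp

/-- The common denominator of the right-hand certificate. -/
noncomputable def denR (n : ℝ) : ℝ :=
  32 * (n + 1) ^ 2 * (n + 2) ^ 4 * (2 * n + 1) ^ 2 * (2 * n + 3) ^ 5 * quart n

/-- The transcendental factor of the telescoping companion on the right-hand side. -/
noncomputable def certR (n : ℕ) (t : ℝ) : ℝ :=
  certRA n t * Sh n t - (t - 1) ^ 2 * (t + 3 * n) * certRB n t * Sh n (t - 1)

/-- The telescoping companion of the second-order operator applied to `Rtilde n 0`. -/
noncomputable def compR (n : ℕ) (t : ℝ) : ℝ :=
  poch (t - n - 1) (n + 1) * certR n t /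
    ((t + n) * (t + n + 1) * poch t (2 * n + 4)) / denR n

theorem denR_pos (n : ℕ) : 0 < denR n := by
  have := quart_pos n
  rw [denR]
  positivity

theorem certR_eq (n : ℕ) (t : ℝ) :
    certR n t = (certRA n t - certRB n t * recCoeff n (t - 1)) * Sh n t +
      t ^ 2 * (t + n) * certRB n t * Sh n (t + 1) := by
  have h := Sh_rec n (t - 1)
  rw [show t - 1 + 2 = t + 1 by ring, show t - 1 + 1 = t by ring] at h
  rw [certR]
  linear_combination -certRB n t * h

/-- The difference `Rtilde (n + 1) 0 - mult n * Rtilde n 0`. -/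
noncomputable def diffR (n : ℕ) (t : ℝ) : ℝ := Rtilde (n + 1) 0 t - mult n * Rtilde n 0 t

theorem denR_mul_telescope (n : ℕ) (t : ℝ) :
    denR n * ((t - n - 2) * (t - n - 1) * (t + n) * (t + n + 1) * Sh (n + 2) t +
      (rho n - mult (n + 1)) * ((t - n - 1) * (t + n) * (t + n + 2) * (t + 2 * n + 3) *
        (t + 2 * n + 4)) * Sh (n + 1) t -
      rho n * mult n * ((t + n + 1) * (t + n + 2) * ((t + 2 * n + 1) * (t + 2 * n + 2) *
        (t + 2 * n + 3) * (t + 2 * n + 4))) * Sh n t) =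
    t ^ 2 * (t + n) * certR n (t + 1) -
      (t - n - 1) * (t + n + 2) * (t + 2 * n + 4) * certR n t := by
  have c0 := Sh_contiguous n t
  have c1 := Sh_contiguous n (t + 1)
  have c2 := Sh_contiguous (n + 1) t
  have hr := Sh_rec n t
  have pA := cert_left n t
  have pB := cert_right n t
  have k1 : denR n * (rho n - mult (n + 1)) =
      4 * (n + 1) ^ 2 * (2 * n + 1) ^ 2 * ((n + 1) ^ 7 * (4 * n + 3) * (4 * n + 5) * quart (n + 1) +
        128 * (2 * n + 3) ^ 9 * quart n) := by
    have hq := (quart_pos n).ne'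
    simp only [denR, rho, mult]
    field_simp
    ring
  have k2 : denR n * (rho n * mult n) =
      -(64 * (n + 1) ^ 5 * (4 * n + 3) * (4 * n + 5) * (2 * n + 1) ^ 6 * quart (n + 1)) := by
    have hq := (quart_pos n).ne'
    simp only [denR, rho, mult]
    field_simp
    ring
  have k3 : denR n = 2 * (n + 2) ^ 2 * (2 * n + 3) ^ 3 * quart n *
      ((4 * (n + 1) ^ 2 * (2 * n + 1) ^ 2) * (4 * (n + 2) ^ 2 * (2 * n + 3) ^ 2)) := by
    rw [denR]; ring
  rw [show t + 1 + 1 = t + 2 by ring] at c1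
  replace c2 : 4 * (n + 2) ^ 2 * (2 * n + 3) ^ 2 * Sh (n + 2) t =
      contA (n + 1) t * Sh (n + 1) t + t ^ 2 * contB (n + 1) t * Sh (n + 1) (t + 1) := by
    push_cast at c2
    linear_combination c2
  rw [certR_eq n t, certR, show t + 1 - 1 = t by ring]
  linear_combination ((t - n - 2) * (t - n - 1) * (t + n) * (t + n + 1) * Sh (n + 2) t) * k3 +
    ((t - n - 1) * (t + n) * (t + n + 2) * (t + 2 * n + 3) * (t + 2 * n + 4) * Sh (n + 1) t) * k1 -
    ((t + n + 1) * (t + n + 2) * ((t + 2 * n + 1) * (t + 2 * n + 2) *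
      (t + 2 * n + 3) * (t + 2 * n + 4)) * Sh n t) * k2 +
    (2 * (n + 2) ^ 2 * (2 * n + 3) ^ 3 * quart n * (4 * (n + 1) ^ 2 * (2 * n + 1) ^ 2) *
      ((t - n - 2) * (t - n - 1) * (t + n) * (t + n + 1))) * c2 +
    (2 * (n + 2) ^ 2 * (2 * n + 3) ^ 3 * quart n *
      ((t - n - 2) * (t - n - 1) * (t + n) * (t + n + 1)) * contA (n + 1) t +
      ((n + 1) ^ 7 * (4 * n + 3) * (4 * n + 5) * quart (n + 1) +
        128 * (2 * n + 3) ^ 9 * quart n) *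
      ((t - n - 1) * (t + n) * (t + n + 2) * (t + 2 * n + 3) * (t + 2 * n + 4))) * c0 +
    (2 * (n + 2) ^ 2 * (2 * n + 3) ^ 3 * quart n *
      ((t - n - 2) * (t - n - 1) * (t + n) * (t + n + 1)) * t ^ 2 * contB (n + 1) t) * c1 +
    (2 * (n + 2) ^ 2 * (2 * n + 3) ^ 3 * quart n * ((t - n - 2) * (t - n - 1) * (t + n)) *
      t ^ 2 * contB (n + 1) t * contB n (t + 1)) * hr + Sh n t * pA + t ^ 2 * Sh n (t + 1) * pB

theorem diffR_telescope (n : ℕ) (t : ℝ) (ht : 0 < t) :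
    diffR (n + 1) t + rho n * diffR n t = compR n (t + 1) - compR n t := by
  have h := denR_mul_telescope n t
  have hd := (denR_pos n).ne'
  have hv := (poch_pos ht (2 * n + 1)).ne'
  have e1 : poch (t - n - 1) (n + 1) = (t - n - 1) * poch (t - n) n := by
    rw [poch_succ', sub_add_cancel]
  have e2 : poch (t - n - 2) (n + 2) = (t - n - 2) * ((t - n - 1) * poch (t - n) n) := by
    rw [poch_succ', ← e1]
    ring_nf
  have e3 : poch (t - n) (n + 1) = poch (t - n) n * t := by rw [poch_succ, sub_add_cancel]
  have e4 : poch t (2 * n + 3) = poch t (2 * n + 1) * (t + 2 * n + 1) * (t + 2 * n + 2) := by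
    rw [poch_succ, poch_succ]; push_cast; ring
  have e5 : poch t (2 * n + 4) =
      poch t (2 * n + 1) * (t + 2 * n + 1) * (t + 2 * n + 2) * (t + 2 * n + 3) := by
    rw [poch_succ, e4]; push_cast; ring
  have e6 : poch t (2 * n + 5) =
      poch t (2 * n + 1) * (t + 2 * n + 1) * (t + 2 * n + 2) * (t + 2 * n + 3) *
        (t + 2 * n + 4) := by
    rw [poch_succ, e5]; push_cast; ring
  have e7 : poch (t + 1) (2 * n + 4) =
      poch t (2 * n + 1) * (t + 2 * n + 1) * (t + 2 * n + 2) * (t + 2 * n + 3) *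
        (t + 2 * n + 4) / t := by
    rw [← e6, eq_div_iff ht.ne', mul_comm, ← poch_succ']
  rw [diffR, diffR, Rtilde_zero_eq _ ht, Rtilde_zero_eq _ ht, Rtilde_zero_eq _ ht, compR, compR,
    show 2 * (n + 1 + 1) + 1 = 2 * n + 5 by ring, show 2 * (n + 1) + 1 = 2 * n + 3 by ring,
    show n + 1 + 1 = n + 2 by ring]
  push_cast
  rw [show t - (n + 2 : ℝ) = t - n - 2 by ring, show t - (n + 1 : ℝ) = t - n - 1 by ring,
    show t + 1 - n - 1 = t - n by ring, show t + (n + 2 : ℝ) = t + n + 2 by ring,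
    show t + (n + 1 : ℝ) = t + n + 1 by ring, show t + 1 + (n : ℝ) = t + n + 1 by ring,
    show t + n + 1 + (1 : ℝ) = t + n + 2 by ring, e1, e2, e3, e4, e5, e6, e7]
  have d0 : t + n ≠ 0 := by positivity
  have d1 : t + n + 1 ≠ 0 := by positivity
  have d2 : t + n + 2 ≠ 0 := by positivity
  have d3 : t + 2 * n + 1 ≠ 0 := by positivity
  have d4 : t + 2 * n + 2 ≠ 0 := by positivity
  have d5 : t + 2 * n + 3 ≠ 0 := by positivity
  have d6 : t + 2 * n + 4 ≠ 0 := by positivity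
  have d7 : t ≠ 0 := ht.ne'
  clear e1 e2 e3 e4 e5 e6 e7
  generalize poch t (2 * n + 1) = v at *
  generalize poch (t - n) n = u at *
  generalize Sh n t = s0 at *
  generalize Sh (n + 1) t = s1 at *
  generalize Sh (n + 2) t = s2 at *
  generalize certR n t = c0 at *
  generalize certR n (t + 1) = c1 at *
  generalize rho n = ρ at *
  generalize mult (n + 1) = m1 at *
  generalize mult n = m0 at *
  generalize denR n = d at *
  generalize t + (n : ℝ) + 2 = x2 at *
  generalize t + (n : ℝ) + 1 = x1 at *
  generalize t + (n : ℝ) = x0 at *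
  generalize t - (n : ℝ) - 2 = z2 at *
  generalize t - (n : ℝ) - 1 = z1 at *
  generalize t + 2 * (n : ℝ) + 1 = y1 at *
  generalize t + 2 * (n : ℝ) + 2 = y2 at *
  generalize t + 2 * (n : ℝ) + 3 = y3 at *
  generalize t + 2 * (n : ℝ) + 4 = y4 at *
  obtain ⟨w, hw⟩ : ∃ w, w = u / (d * v * (x0 * x1 * x2) *
    (y1 * y2 * y3 * y4)) := ⟨_, rfl⟩
  have q0 : u * s0 / (x0 * v) = w * (d * (x1 * x2 *
      (y1 * y2 * y3 * y4) * s0)) := by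
    rw [hw]
    field_simp
  have q1 : z1 * u * s1 / (x1 * (v * y1 * y2)) =
      w * (d * (z1 * x0 * x2 * y3 * y4 * s1)) := by
    rw [hw]
    field_simp
  have q2 : z2 * (z1 * u) * s2 / (x2 *
      (v * y1 * y2 * y3 * y4)) =
      w * (d * (z2 * z1 * x0 * x1 * s2)) := by
    rw [hw]
    field_simp
  have q3 : z1 * u * c0 / (x0 * x1 *
      (v * y1 * y2 * y3)) / d =
      w * (z1 * x2 * y4 * c0) := by
    rw [hw]
    field_simp
  have q4 : u * t * c1 / (x1 * x2 *
      (v * y1 * y2 * y3 * y4 / t)) / d =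
      w * (t ^ 2 * x0 * c1) := by
    rw [hw]
    field_simp
  rw [q0, q1, q2, q3, q4]
  linear_combination w * h

theorem RatDecay.horner_sub {k l : ℤ} {f : ℝ → ℝ} {a : ℝ} {d e : ℕ} (c : ℝ)
    (hf : RatDecay k (fun t => f t - a * t ^ d)) (hk : k ≤ 0) (hl : l + 1 ≤ k)
    (he : e = d + 1) : RatDecay l (fun t => c + t * f t - a * t ^ e) :=
  ((hf.horner c hk).mono (by lia)).congr fun t _ => by rw [he]; ring

theorem RatDecay.horner_sub_linear (c a : ℝ) :
    RatDecay 0 (fun t => c + t * a - a * t ^ 1) :=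
  (RatDecay.const c).congr fun t _ => by ring

theorem ratDecay_Sh (n : ℕ) : RatDecay (-n) (Sh n) := by
  refine (RatDecay.sum (k := -n) (Finset.range (n + 1)) (fun j t => wt n j * poch (t + -j) n)
    (by lia) fun j _ => (RatDecay.poch _ _).const_mul _).congr fun t _ => ?_
  simp only [Sh, sub_eq_add_neg]

theorem poch_sub_poch (x : ℝ) (k : ℕ) :
    poch x (k + 1) - poch (x - 1) (k + 1) = (k + 1) * poch x k := by
  rw [poch_succ, poch_succ', sub_add_cancel]
  ring

theorem ratDecay_Sh_sub (n : ℕ) : RatDecay (1 - n) (fun t => Sh n t - Sh n (t - 1)) := by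
  rcases n with _ | m
  · refine (((RatDecay.inv_linear le_rfl).const_mul 0).mono (by simp)).congr fun t _ => ?_
    simp [Sh, poch_zero]
  · refine ((RatDecay.sum (k := -m) (Finset.range (m + 1 + 1))
      (fun j t => wt (m + 1) j * (m + 1) * poch (t + -j) m) (by lia)
      fun j _ => (RatDecay.poch _ _).const_mul _).mono (by push_cast; lia)).congr fun t _ => ?_
    simp only [Sh, ← Finset.sum_sub_distrib, ← mul_sub]
    refine Finset.sum_congr rfl fun j _ => ?_
    rw [sub_right_comm, poch_sub_poch, sub_eq_add_neg]
    ring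

theorem ratDecay_certRA_sub (n : ℝ) :
    RatDecay (-6) (fun t => certRA n t - certTop n * t ^ 7) := by
  simp only [certRA]
  refine RatDecay.horner_sub (k := -5) (d := 6) _ ?_ (by lia) (by lia) rfl
  refine RatDecay.horner_sub (k := -4) (d := 5) _ ?_ (by lia) (by lia) rfl
  refine RatDecay.horner_sub (k := -3) (d := 4) _ ?_ (by lia) (by lia) rfl
  refine RatDecay.horner_sub (k := -2) (d := 3) _ ?_ (by lia) (by lia) rfl
  refine RatDecay.horner_sub (k := -1) (d := 2) _ ?_ (by lia) (by lia) rfl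
  refine RatDecay.horner_sub (k := 0) (d := 1) _ ?_ (by lia) (by lia) rfl
  exact RatDecay.horner_sub_linear _ _

theorem ratDecay_certRB_sub (n : ℝ) :
    RatDecay (-3) (fun t => certRB n t - certTop n * t ^ 4) := by
  simp only [certRB]
  refine RatDecay.horner_sub (k := -2) (d := 3) _ ?_ (by lia) (by lia) rfl
  refine RatDecay.horner_sub (k := -1) (d := 2) _ ?_ (by lia) (by lia) rfl
  refine RatDecay.horner_sub (k := 0) (d := 1) _ ?_ (by lia) (by lia) rfl
  exact RatDecay.horner_sub_linear _ _

theorem ratDecay_certRB (n : ℝ) : RatDecay (-4) (certRB n) :=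
  (((ratDecay_certRB_sub n).mono (by lia)).add
    (((RatDecay.id.pow 4).const_mul (certTop n)).mono (by lia))).congr fun t _ => by ring

theorem ratDecay_certR (n : ℕ) : RatDecay (-6 - n) (certR n) := by
  have hb := ratDecay_certRB n
  have hq : RatDecay (-2) (fun t => (t + -1) ^ 2 * (t + 3 * n) - t ^ 3) :=
    ((((RatDecay.const (3 * n - 2)).horner (1 - 6 * n) (by lia)).horner (3 * n)
      (by lia)).mono (by lia)).congr fun t _ => by ring
  have h := ((((ratDecay_certRA_sub n).sub (((RatDecay.id.pow 3).mul
    (ratDecay_certRB_sub n)).mono (by lia))).sub ((hq.mul hb).mono (by lia))).mul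
      (ratDecay_Sh n)).mono (l := -6 - n) (by lia)
  have h' := ((((((RatDecay.linear (-1)).pow 2).mul (RatDecay.linear (3 * n))).mul hb).mul
    (ratDecay_Sh_sub n))).mono (l := -6 - n) (by push_cast; lia)
  refine (h.add h').congr fun t _ => ?_
  rw [certR]
  ring

theorem ratDecay_compR (n : ℕ) : RatDecay (-1) (compR n) := by
  have h := ((((((RatDecay.poch (-n - 1) (n + 1)).mul (ratDecay_certR n)).mul
    (RatDecay.inv_linear (c := n) (by positivity))).mul
    (RatDecay.inv_linear (c := n + 1) (by positivity))).mul
    (RatDecay.inv_poch le_rfl (2 * n + 4))).mul (RatDecay.const (denR n)⁻¹)).mono (l := -1)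
      (by push_cast; lia)
  refine h.congr fun t _ => ?_
  rw [compR, add_zero, show t + (-n - 1 : ℝ) = t - n - 1 by ring, add_assoc t n 1]
  simp only [div_eq_mul_inv, mul_inv]
  ring

theorem ratDecay_Rtilde (n : ℕ) : RatDecay 2 (Rtilde n 0) := by
  have h := ((((RatDecay.poch (-n) n).mul (ratDecay_Sh n)).mul
    (RatDecay.inv_linear (c := n) (by positivity))).mul
    (RatDecay.inv_poch le_rfl (2 * n + 1))).mono (l := 2) (by push_cast; lia)
  refine h.congr fun t ht => ?_
  rw [Rtilde_zero_eq n ht, add_zero]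
  simp only [div_eq_mul_inv, mul_inv, sub_eq_add_neg]
  ring

theorem ratDecay_diffR (n : ℕ) : RatDecay 2 (diffR n) :=
  (ratDecay_Rtilde (n + 1)).sub ((ratDecay_Rtilde n).const_mul _)

theorem RatDecay.tsum_deriv_deriv_telescope {k : ℤ} {f G : ℝ → ℝ} (hf : RatDecay 2 f) (hk : -1 ≤ k)
    (hG : RatDecay k G) (h : ∀ t, 0 < t → f t = G (t + 1) - G t) :
    ∑' ν : ℕ, _root_.deriv (_root_.deriv f) (1 + (ν : ℝ)) = -_root_.deriv (_root_.deriv G) 1 :=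
  tsum_telescope (hG.deriv.deriv.tendsto (by lia))
    (fun ν => deriv_telescope hG.deriv (deriv_telescope hG h) _ (by positivity))
    (hf.deriv.deriv.summable (by lia) one_pos)

theorem RatDecay.tsum_deriv_deriv_add {f g : ℝ → ℝ} (hf : RatDecay 2 f) (hg : RatDecay 2 g)
    (c : ℝ) :
    ∑' ν : ℕ, _root_.deriv (_root_.deriv fun t => f t + c * g t) (1 + (ν : ℝ)) =
      ∑' ν : ℕ, _root_.deriv (_root_.deriv f) (1 + (ν : ℝ)) +
        c * ∑' ν : ℕ, _root_.deriv (_root_.deriv g) (1 + (ν : ℝ)) := by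
  have h1 : ∀ {f g : ℝ → ℝ} {k : ℤ} (_ : RatDecay k f) (_ : RatDecay k g) (t : ℝ), 0 < t →
      _root_.deriv (fun t => f t + c * g t) t = _root_.deriv f t + c * _root_.deriv g t := by
    intro f g k hf hg t ht
    rw [deriv_fun_add (hf.differentiableAt ht) ((hg.differentiableAt ht).const_mul _),
      deriv_const_mul _ (hg.differentiableAt ht)]
  have h2 : ∀ t : ℝ, 0 < t → _root_.deriv (_root_.deriv fun t => f t + c * g t) t =
      _root_.deriv (_root_.deriv f) t + c * _root_.deriv (_root_.deriv g) t := by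
    intro t ht
    rw [← h1 hf.deriv hg.deriv t ht]
    refine Filter.EventuallyEq.deriv_eq ?_
    filter_upwards [lt_mem_nhds ht] with x hx using h1 hf hg x hx
  rw [← tsum_mul_left, ← Summable.tsum_add (hf.deriv.deriv.summable (by lia) one_pos)
    ((hg.deriv.deriv.summable (by lia) one_pos).mul_left c)]
  exact tsum_congr fun ν => h2 _ (by positivity)

/-- The series of second derivatives of `diffR n`. -/
noncomputable def sumR (n : ℕ) : ℝ := (1 / 6) * ∑' ν : ℕ, deriv (deriv (diffR n)) (1 + (ν : ℝ))

theorem Zr_succ (n : ℕ) : Zr (n + 1) 0 = mult n * Zr n 0 + sumR n := by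
  have h := (ratDecay_Rtilde (n + 1)).tsum_deriv_deriv_add (ratDecay_Rtilde n) (-mult n)
  have e : (fun t => Rtilde (n + 1) 0 t + -mult n * Rtilde n 0 t) = diffR n := by
    ext t; rw [diffR]; ring
  rw [e] at h
  rw [Zr, Zr, sumR, h]
  ring

theorem sumR_succ (n : ℕ) :
    sumR (n + 1) = -rho n * sumR n - (1 / 6) * deriv (deriv (compR n)) 1 := by
  have h := (ratDecay_diffR (n + 1)).tsum_deriv_deriv_add (ratDecay_diffR n) (rho n)
  rw [((ratDecay_diffR (n + 1)).add ((ratDecay_diffR n).const_mul _)).tsum_deriv_deriv_telescope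
    le_rfl (ratDecay_compR n) (diffR_telescope n)] at h
  rw [sumR, sumR]
  linear_combination -(1 / 6 : ℝ) * h

theorem HasDerivAt.mul_log {f g : ℝ → ℝ} {a L M : ℝ} (hf : HasDerivAt f (f a * L) a)
    (hg : HasDerivAt g (g a * M) a) :
    HasDerivAt (fun t => f t * g t) (f a * g a * (L + M)) a :=
  (hf.fun_mul hg).congr_deriv (by ring)

theorem hasDerivAt_inv_log {f : ℝ → ℝ} {a L : ℝ} (hf : HasDerivAt f (f a * L) a) (h : f a ≠ 0) :
    HasDerivAt (fun t => (f t)⁻¹) ((f a)⁻¹ * -L) a :=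
  (hf.fun_inv h).congr_deriv (by field_simp)

theorem hasDerivAt_linear_log {a c : ℝ} (h : a + c ≠ 0) :
    HasDerivAt (fun t => t + c) ((a + c) * (a + c)⁻¹) a :=
  ((hasDerivAt_id a).add_const c).congr_deriv (by field_simp)

theorem hasDerivAt_sq_mul {q : ℝ → ℝ} {a : ℝ} (hq : DifferentiableAt ℝ q a) :
    HasDerivAt (fun t => (t - a) ^ 2 * q t) 0 a :=
  ((((hasDerivAt_id a).sub_const a).fun_pow 2).fun_mul hq.hasDerivAt).congr_deriv (by simp)

theorem hasDerivAt_of_taylor {f q : ℝ → ℝ} {a b c : ℝ} (hq : DifferentiableAt ℝ q a)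
    (h : ∀ t, f t = b + c * (t - a) + (t - a) ^ 2 * q t) : HasDerivAt f c a := by
  have := ((((hasDerivAt_id a).sub_const a).const_mul c).const_add b).fun_add (hasDerivAt_sq_mul hq)
  rw [funext h]
  exact this.congr_deriv (by simp)

theorem S1_zero : S1 0 = 0 := by simp [S1]

theorem S1_succ (n : ℕ) : S1 (n + 1) = S1 n + (n + 1 : ℝ)⁻¹ := by
  simp [S1, Finset.sum_range_succ]

theorem hasDerivAt_poch_one (k : ℕ) : HasDerivAt (fun t => poch t k) (poch 1 k * S1 k) 1 := by
  induction k with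
  | zero => simpa [poch_zero, S1_zero] using hasDerivAt_const (1 : ℝ) (1 : ℝ)
  | succ k ih =>
    have h := HasDerivAt.mul_log ih
      (hasDerivAt_linear_log (a := 1) (c := k) (by positivity))
    simp only [poch_succ, S1_succ]
    rwa [add_comm (k : ℝ) 1]

theorem hasDerivAt_poch_neg (k : ℕ) :
    HasDerivAt (fun t => poch (t - k - 1) k) (poch (1 - k - 1) k * -S1 k) 1 := by
  induction k with
  | zero => simpa [poch_zero, S1_zero] using hasDerivAt_const (1 : ℝ) (1 : ℝ)
  | succ k ih =>
    have hk : (k : ℝ) + 1 ≠ 0 := by positivity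
    have h := HasDerivAt.mul_log (hasDerivAt_linear_log (a := 1) (c := -(k + 2))
      (by intro h; exact hk (by linarith))) ih
    have e : ∀ t : ℝ, poch (t - (k + 1 : ℕ) - 1) (k + 1) = (t + -(k + 2)) * poch (t - k - 1) k := by
      intro t
      rw [poch_succ']
      push_cast
      ring_nf
    simp only [e, S1_succ]
    refine h.congr_deriv ?_
    rw [show (1 : ℝ) + -(k + 2) = -(k + 1) by ring, inv_neg]
    ring

theorem Sh_differentiableAt (n : ℕ) (t : ℝ) : DifferentiableAt ℝ (Sh n) t := by
  unfold Sh poch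
  fun_prop

theorem hasDerivAt_Sh (n : ℕ) : HasDerivAt (Sh n) (Sh n 1 * (S1 n + S1 (2 * n))) 1 := by
  induction n with
  | zero =>
    have : Sh 0 = fun _ => 1 := by ext t; simp [Sh, wt, poch_zero]
    simpa [this, S1_zero] using hasDerivAt_const (1 : ℝ) (1 : ℝ)
  | succ n ih =>
    have hA : HasDerivAt (contA n) ((20 + 145 * n + 315 * n ^ 2 + 216 * n ^ 3) * (n + 1) +
        2 * (-1 - 69 * n - 213 * n ^ 2 - 171 * n ^ 3) - 3 * (33 + 105 * n + 85 * n ^ 2)) 1 := by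
      refine hasDerivAt_of_taylor (b := contA n 1) (q := fun t =>
        (-1 - 69 * n - 213 * n ^ 2 - 171 * n ^ 3) - (33 + 105 * n + 85 * n ^ 2) * (t + 2))
        (by fun_prop) fun t => ?_
      simp only [contA]
      ring
    have hB : HasDerivAt (contB n) (33 + 105 * n + 85 * n ^ 2) 1 := by
      refine hasDerivAt_of_taylor (b := contB n 1) (q := fun t => 0) (by fun_prop) fun t => ?_
      simp only [contB]
      ring
    have hr : HasDerivAt (fun t => recCoeff n (t - 1)) (3 + 3 * n - n ^ 2) 1 := by
      refine hasDerivAt_of_taylor (b := recCoeff n 0)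
        (q := fun t => 4 * n + 4 + 2 * (t - 1)) (by fun_prop) fun t => ?_
      simp only [recCoeff]
      ring
    have hn : (1 : ℝ) + n ≠ 0 := by positivity
    have hn' : (n : ℝ) + 1 ≠ 0 := by positivity
    have hn2 : 2 * (n : ℝ) + 1 ≠ 0 := by positivity
    have hP : HasDerivAt (fun t => contA n t * (t + n) + contB n t * recCoeff n (t - 1))
        ((contA n 1 * (1 + n) + contB n 1 * recCoeff n (1 - 1)) *
          (3 * (n + 1 : ℝ)⁻¹ + (2 * n + 1 : ℝ)⁻¹ - (2 * n + 2 : ℝ)⁻¹)) 1 := by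
      refine ((hA.fun_mul ((hasDerivAt_id (1 : ℝ)).add_const (n : ℝ))).fun_add
        (hB.fun_mul hr)).congr_deriv ?_
      rw [show (2 * n + 2 : ℝ) = 2 * (n + 1) by ring]
      simp only [contA, contB, recCoeff, id]
      generalize (n : ℝ) = N at *
      obtain ⟨x, hx⟩ : ∃ x, 2 * N + 1 = x := ⟨_, rfl⟩
      rw [hx] at hn2 ⊢
      field_simp
      rw [← hx]
      ring
    have hZ : DifferentiableAt ℝ (fun t => -(t + 3 * n) * contB n t * Sh n (t - 1) *
        (4 * (n + 1) ^ 2 * (2 * n + 1) ^ 2 : ℝ)⁻¹ * (t + n)⁻¹) 1 := by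
      have h1 : DifferentiableAt ℝ (fun t => Sh n (t - 1)) 1 :=
        (Sh_differentiableAt n _).comp (1 : ℝ) (by fun_prop)
      have h2 : DifferentiableAt ℝ (fun t => (t + n : ℝ)⁻¹) 1 :=
        DifferentiableAt.fun_inv (by fun_prop) hn
      have h3 := hB.differentiableAt
      fun_prop
    have hm := (HasDerivAt.mul_log (HasDerivAt.mul_log hP ih)
      (hasDerivAt_inv_log (hasDerivAt_linear_log hn) hn)).const_mul
        (4 * (n + 1) ^ 2 * (2 * n + 1) ^ 2 : ℝ)⁻¹
    have hs := hm.fun_add (hasDerivAt_sq_mul hZ)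
    have e : ∀ t : ℝ, t + n ≠ 0 → Sh (n + 1) t = (4 * (n + 1) ^ 2 * (2 * n + 1) ^ 2 : ℝ)⁻¹ *
        ((contA n t * (t + n) + contB n t * recCoeff n (t - 1)) * Sh n t * (t + n)⁻¹) +
        (t - 1) ^ 2 * (-(t + 3 * n) * contB n t * Sh n (t - 1) *
          (4 * (n + 1) ^ 2 * (2 * n + 1) ^ 2 : ℝ)⁻¹ * (t + n)⁻¹) := by
      intro t ht
      have h := Sh_rec n (t - 1)
      have h' := Sh_contiguous n t
      rw [show t - 1 + 2 = t + 1 by ring, show t - 1 + 1 = t by ring] at h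
      have hk : (4 * (n + 1) ^ 2 * (2 * n + 1) ^ 2 : ℝ) ≠ 0 := by positivity
      generalize (4 * (n + 1) ^ 2 * (2 * n + 1) ^ 2 : ℝ) = k at *
      field_simp
      linear_combination (t + n) * h' + contB n t * h
    refine (hs.congr_of_eventuallyEq (by
      filter_upwards [lt_mem_nhds (zero_lt_one' ℝ)] with t ht using e t (by positivity))).congr_deriv
        ?_
    rw [e 1 hn, show 2 * (n + 1) = 2 * n + 1 + 1 by ring, S1_succ, S1_succ, S1_succ]
    push_cast
    rw [show 2 * (n : ℝ) + 1 + 1 = 2 * (n + 1) by ring, show 2 * (n : ℝ) + 2 = 2 * (n + 1) by ring,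
      mul_inv 2 ((n : ℝ) + 1), add_comm (1 : ℝ) n]
    ring

theorem hasDerivAt_horner_seven (c₀ c₁ c₂ c₃ c₄ c₅ c₆ c₇ : ℝ) :
    HasDerivAt (fun t => c₀ + t * (c₁ + t * (c₂ + t * (c₃ + t * (c₄ + t * (c₅ + t *
      (c₆ + t * c₇)))))))
      (c₁ + 2 * c₂ + 3 * c₃ + 4 * c₄ + 5 * c₅ + 6 * c₆ + 7 * c₇) 1 := by
  refine hasDerivAt_of_taylor (b := c₀ + c₁ + c₂ + c₃ + c₄ + c₅ + c₆ + c₇)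
    (q := fun t => c₂ + c₃ * (t + 2) + c₄ * (t ^ 2 + 2 * t + 3) +
      c₅ * (t ^ 3 + 2 * t ^ 2 + 3 * t + 4) + c₆ * (t ^ 4 + 2 * t ^ 3 + 3 * t ^ 2 + 4 * t + 5) +
      c₇ * (t ^ 5 + 2 * t ^ 4 + 3 * t ^ 3 + 4 * t ^ 2 + 5 * t + 6)) (by fun_prop) fun t => ?_
  ring

theorem hasDerivAt_certRA (n : ℕ) : HasDerivAt (certRA n) (certRA n 1 * ((n + 1 : ℝ)⁻¹ +
    (n + 2 : ℝ)⁻¹ + (2 * n + 1 : ℝ)⁻¹ + (2 * n + 2 : ℝ)⁻¹ + (2 * n + 3 : ℝ)⁻¹ +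
    (2 * n + 4 : ℝ)⁻¹)) 1 := by
  refine (hasDerivAt_horner_seven _ _ _ _ _ _ _ _).congr_deriv ?_
  have h1 : (n : ℝ) + 1 ≠ 0 := by positivity
  have h2 : (n : ℝ) + 2 ≠ 0 := by positivity
  have h3 : 2 * (n : ℝ) + 1 ≠ 0 := by positivity
  have h4 : 2 * (n : ℝ) + 3 ≠ 0 := by positivity
  rw [show (2 * n + 2 : ℝ) = 2 * (n + 1) by ring, show (2 * n + 4 : ℝ) = 2 * (n + 2) by ring]
  simp only [certRA, certTop]
  generalize (n : ℝ) = N at *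
  have e : (N + 1)⁻¹ + (N + 2)⁻¹ + (2 * N + 1)⁻¹ + (2 * (N + 1))⁻¹ + (2 * N + 3)⁻¹ +
      (2 * (N + 2))⁻¹ = ((3 * (2 * N + 3) * (2 * N + 1) * (2 * N + 3) +
        2 * (N + 1) * (N + 2) * (4 * N + 4))) /
        (2 * (N + 1) * (N + 2) * ((2 * N + 1) * (2 * N + 3))) := by
    obtain ⟨x, hx⟩ : ∃ x, 2 * N + 1 = x := ⟨_, rfl⟩
    obtain ⟨y, hy⟩ : ∃ y, 2 * N + 3 = y := ⟨_, rfl⟩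
    rw [hx] at h3 ⊢
    rw [hy] at h4 ⊢
    field_simp
    rw [← hx, ← hy]
    ring
  rw [e, ← mul_div_assoc, eq_div_iff (by simp [*])]
  ring

theorem certR_one (n : ℕ) : certR n 1 = certRA n 1 * Sh n 1 := by simp [certR]

theorem hasDerivAt_certR (n : ℕ) : HasDerivAt (certR n) (certR n 1 * ((n + 1 : ℝ)⁻¹ +
    (n + 2 : ℝ)⁻¹ + (2 * n + 1 : ℝ)⁻¹ + (2 * n + 2 : ℝ)⁻¹ + (2 * n + 3 : ℝ)⁻¹ +
    (2 * n + 4 : ℝ)⁻¹ + (S1 n + S1 (2 * n)))) 1 := by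
  have hZ : DifferentiableAt ℝ (fun t => -(t + 3 * n) * certRB n t * Sh n (t - 1)) 1 := by
    have h1 : DifferentiableAt ℝ (fun t => Sh n (t - 1)) 1 :=
      (Sh_differentiableAt n _).comp (1 : ℝ) (by fun_prop)
    have h2 := (ratDecay_certRB n).differentiableAt one_pos
    fun_prop
  have h := (HasDerivAt.mul_log (hasDerivAt_certRA n) (hasDerivAt_Sh n)).fun_add
    (hasDerivAt_sq_mul hZ)
  rw [certR_one, ← add_zero (certRA n 1 * Sh n 1 * _)]
  refine h.congr_of_eventuallyEq (.of_forall fun t => ?_)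
  rw [certR]
  ring

theorem deriv_deriv_of_simple_zero {k : ℤ} {f g : ℝ → ℝ} {a : ℝ} (ha : 0 < a)
    (hf : ∀ t, 0 < t → f t = (t - a) * g t) (hg : RatDecay k g) :
    deriv (deriv f) a = 2 * deriv g a := by
  have h1 : ∀ t, 0 < t → deriv f t = g t + (t - a) * deriv g t := by
    intro t ht
    have e : f =ᶠ[nhds t] fun t => (t - a) * g t := by
      filter_upwards [lt_mem_nhds ht] with x hx using hf x hx
    rw [e.deriv_eq, (((hasDerivAt_id' t).sub_const a).fun_mul
      (hg.differentiableAt ht).hasDerivAt).deriv]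
    simp
  have e : deriv f =ᶠ[nhds a] fun t => g t + (t - a) * deriv g t := by
    filter_upwards [lt_mem_nhds ha] with x hx using h1 x hx
  rw [e.deriv_eq, ((hg.differentiableAt ha).hasDerivAt.fun_add
    (((hasDerivAt_id' a).sub_const a).fun_mul (hg.deriv.differentiableAt ha).hasDerivAt)).deriv]
  simp only [sub_self]
  ring

theorem deriv_deriv_compR (n : ℕ) : deriv (deriv (compR n)) 1 = 0 := by
  have hr := (((((RatDecay.poch (-n - 1) n).mul (ratDecay_certR n)).mul
    (RatDecay.inv_linear (c := n) (by positivity))).mul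
    (RatDecay.inv_linear (c := n + 1) (by positivity))).mul
    (RatDecay.inv_poch le_rfl (2 * n + 4))).mul (RatDecay.const (denR n)⁻¹)
  rw [deriv_deriv_of_simple_zero one_pos (fun t ht => ?_) hr]
  · have h1 : (1 : ℝ) + n ≠ 0 := by positivity
    have h2 : (1 : ℝ) + (n + 1) ≠ 0 := by positivity
    have hd := (((((HasDerivAt.mul_log (hasDerivAt_poch_neg n) (hasDerivAt_certR n)).mul_log
      (hasDerivAt_inv_log (hasDerivAt_linear_log h1) h1)).mul_log
      (hasDerivAt_inv_log (hasDerivAt_linear_log h2) h2)).mul_log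
      (hasDerivAt_inv_log (hasDerivAt_poch_one (2 * n + 4))
        (poch_pos one_pos _).ne')).mul_const (denR n)⁻¹)
    have e : ∀ t : ℝ, t + (-n - 1) = t - n - 1 := fun t => by ring
    simp only [e, add_zero]
    rw [hd.deriv, show 2 * n + 4 = 2 * n + 1 + 1 + 1 + 1 by ring]
    simp only [S1_succ]
    push_cast
    ring
  · have e : poch (t - n - 1) (n + 1) = poch (t - n - 1) n * (t - 1) := by
      rw [poch_succ]; ring
    rw [compR, e, add_zero, show t + (-n - 1 : ℝ) = t - n - 1 by ring, add_assoc t n 1]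
    simp only [div_eq_mul_inv, mul_inv]
    ring

theorem deriv_eq_of_pos {f g : ℝ → ℝ} {g' t : ℝ} (h : ∀ x, 0 < x → f x = g x) (ht : 0 < t)
    (hg : HasDerivAt g g' t) : deriv f t = g' := by
  refine (hg.congr_of_eventuallyEq ?_).deriv
  filter_upwards [lt_mem_nhds ht] with x hx using h x hx

theorem hasDerivAt_inv_pow (c : ℝ) (k : ℕ) {t : ℝ} (h : t + c ≠ 0) :
    HasDerivAt (fun t => ((t + c) ^ k)⁻¹) (-k * ((t + c) ^ (k + 1))⁻¹) t := by
  refine ((((hasDerivAt_id' t).add_const c).fun_pow k).fun_inv (pow_ne_zero _ h)).congr_deriv ?_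
  rcases k with _ | k
  · simp
  · simp only [Nat.add_sub_cancel]
    field_simp
    ring

theorem Zl_zero_eq_Zr_zero : Zl 0 0 = Zr 0 0 := by
  have h1 : ∀ t : ℝ, 0 < t → R 0 0 t = ((t + 0) ^ 3)⁻¹ := by
    intro t ht
    simp [R, poch]
    field_simp
  have h2 : ∀ t : ℝ, 0 < t → Rtilde 0 0 t = ((t + 0) ^ 2)⁻¹ := by
    intro t ht
    simp [Rtilde, poch]
    field_simp
  have h3 : ∀ t : ℝ, 0 < t → deriv (Rtilde 0 0) t = -(2 : ℕ) * ((t + 0) ^ 3)⁻¹ := fun t ht =>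
    deriv_eq_of_pos h2 ht (hasDerivAt_inv_pow 0 2 (by simpa using ht.ne'))
  rw [Zl, Zr, ← tsum_mul_left, ← tsum_mul_left]
  refine tsum_congr fun ν => ?_
  have hν : (0 : ℝ) < 1 + ν := by positivity
  have hd := hasDerivAt_inv_pow 0 3 (by simpa using hν.ne')
  rw [show ((0 : ℕ) : ℝ) - (0 : ℕ) + 1 + ν = 1 + ν by simp, deriv_eq_of_pos h1 hν hd,
    deriv_eq_of_pos h3 hν (hd.const_mul _)]
  push_cast
  ring

theorem sumR_zero : sumR 0 = 277 / 16 := by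
  have hG : RatDecay 1 (fun t => -16 * ((t + 0) ^ 2)⁻¹ - 3 / 2 * ((t + 0) ^ 1)⁻¹ -
      39 / 2 * ((t + 1) ^ 1)⁻¹) :=
    ((((((RatDecay.inv_linear le_rfl).pow 2).mono (by lia)).const_mul (-16)).sub
      ((RatDecay.inv_linear le_rfl).const_mul (3 / 2))).sub
      ((RatDecay.inv_linear zero_le_one).const_mul (39 / 2))).congr fun t _ => by
        simp only [inv_pow, pow_one]
  have h := (ratDecay_diffR 0).tsum_deriv_deriv_telescope (by lia) hG fun t ht => ?_
  · have h1 : ∀ t : ℝ, 0 < t → _ := fun t ht =>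
      (((((hasDerivAt_inv_pow 0 2 (t := t) (by positivity)).const_mul (-16)).fun_sub
        ((hasDerivAt_inv_pow 0 1 (t := t) (by positivity)).const_mul (3 / 2))).fun_sub
        ((hasDerivAt_inv_pow 1 1 (t := t) (by positivity)).const_mul (39 / 2)))).deriv
    have h2 := ((((((hasDerivAt_inv_pow 0 (2 + 1) (t := 1) (by simp)).const_mul
      (-(2 : ℕ) : ℝ)).const_mul (-16)).fun_sub
        (((hasDerivAt_inv_pow 0 (1 + 1) (t := 1) (by simp)).const_mul
          (-(1 : ℕ) : ℝ)).const_mul (3 / 2))).fun_sub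
        (((hasDerivAt_inv_pow 1 (1 + 1) (t := 1) (by norm_num)).const_mul
          (-(1 : ℕ) : ℝ)).const_mul (39 / 2))))
    rw [sumR, h, deriv_eq_of_pos h1 one_pos h2]
    norm_num
  · have e1 : Rtilde 1 0 t = (t - 1) * (5 * t - 3) / (t * (t + 1) ^ 2 * (t + 2)) := by
      have := Rtilde_zero_eq 1 ht
      rw [this]
      simp [Sh, wt, poch, Finset.sum_range_succ, Finset.prod_range_succ, Nat.choose]
      field_simp
      ring
    have e0 : Rtilde 0 0 t = 1 / t ^ 2 := by
      simp [Rtilde, poch]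
      field_simp
    rw [diffR, e0, e1]
    simp only [mult]
    push_cast
    field_simp
    ring

theorem sumR_eq_bdry (n : ℕ) : sumR n = bdry n := by
  induction n with
  | zero =>
    rw [sumR_zero, bdry_eq]
    norm_num [quart]
  | succ n ih => rw [sumR_succ, deriv_deriv_compR, bdry_succ, ih]; ring

/-- For all integers `n ≥ 0`, `Z_l(n,0) = Z_r(n,0)`. -/
theorem Zl_eq_Zr_at_m_zero (n : ℕ) : Zl n 0 = Zr n 0 := by
  induction n with
  | zero => exact Zl_zero_eq_Zr_zero
  | succ n ih => rw [Zl_succ, Zr_succ, ih, sumR_eq_bdry]
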